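/- arXiv:1908.01388 — 2 statements merged into one kernel-verified Lean document; each statement's English description precedes it below -/
import Mathlib

section
/- Let X be a Polish space, let μ be a σ-finite Borel measure on X whose topological support has cardinality s := |supp(μ)| ≥ 2 (possibly s = ∞), and let c(x,y) = 1{x ≠ y} be the discrete metric cost on X. Then 2(1 − 1/s) ≤ r*_c(P_{≪μ}(X)) ≤ min{2, (s+1)/3} (with the conventions 1/∞ = 0 and (∞+1)/3 = ∞); moreover there exists a coupling {X_P}_{P ∈ P_{≪μ}(X)} with r_c({X_P}) ≤ min{2, (s+1)/3}. In particular, if |supp(μ)| = ∞ then r*_c(P_{≪μ}(X)) = 2. -/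
open MeasureTheory ENNReal

noncomputable section

/-- The optimal transport cost `C*_c(P,Q)` between two Borel measures for the cost `c`:
the infimum of `∫ c dγ` over couplings `γ` of `(P, Q)`. -/
def Cstar {X : Type*} [MeasurableSpace X] (c : X → X → ℝ) (P Q : Measure X) : ℝ≥0∞ :=
  ⨅ γ ∈ {γ : Measure (X × X) |
      IsProbabilityMeasure γ ∧ γ.map Prod.fst = P ∧ γ.map Prod.snd = Q},
    ∫⁻ z, ENNReal.ofReal (c z.1 z.2) ∂γ

/-- The standard probability space: `[0,1]` with Lebesgue measure. -/
def stdSpace : Measure ℝ := volume.restrict (Set.Icc (0 : ℝ) 1)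

/-- `f` is a coupling of the family of probability measures `P` on the standard
probability space `([0,1], Lebesgue)`: each `f a` is measurable with law `P a`. -/
structure IsCoupling {X A : Type*} [MeasurableSpace X]
    (P : A → Measure X) (f : A → ℝ → X) : Prop where
  measurable : ∀ a, Measurable (f a)
  law : ∀ a, stdSpace.map (f a) = P a

/-- The pairwise coupling ratio `r_c({X_α})` of a coupling `f` of the family `P`:
the least `r ≥ 1` such that `E[c(X_a, X_b)] ≤ r ⬝ C*_c(P_a, P_b)` for all `a, b`
(`∞` if no such `r` exists). -/
def couplingRatio {X A : Type*} [MeasurableSpace X]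
    (c : X → X → ℝ) (P : A → Measure X) (f : A → ℝ → X) : ℝ≥0∞ :=
  sInf {r : ℝ≥0∞ | 1 ≤ r ∧ ∀ a b : A,
    ∫⁻ u, ENNReal.ofReal (c (f a u) (f b u)) ∂stdSpace ≤ r * Cstar c (P a) (P b)}

/-- The optimal pairwise coupling ratio `r*_c({P_α})` of a family of probability
measures: the infimum of `r_c({X_α})` over all couplings of the family. -/
def optRatio {X A : Type*} [MeasurableSpace X]
    (c : X → X → ℝ) (P : A → Measure X) : ℝ≥0∞ :=
  ⨅ (f : A → ℝ → X) (_ : IsCoupling P f), couplingRatio c P f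

/-- The topological support of a measure: the set of points all of whose open
neighborhoods have positive measure. -/
def msupport {X : Type*} [TopologicalSpace X] [MeasurableSpace X] (μ : Measure X) : Set X :=
  {x : X | ∀ U : Set X, IsOpen U → x ∈ U → 0 < μ U}

open Classical in
/-- The discrete metric cost `c(x,y) = 1{x ≠ y}`. -/
def discreteCost {X : Type*} (x y : X) : ℝ := if x = y then 0 else 1

theorem MeasureTheory.Measure.exists_measurable_map_stdSpace_eq {Ω : Type*} [MeasurableSpace Ω]
    [StandardBorelSpace Ω] (ν : Measure Ω) [IsProbabilityMeasure ν] :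
    ∃ φ : ℝ → Ω, Measurable φ ∧ stdSpace.map φ = ν := by
  have : Nonempty Ω := ν.nonempty_of_neZero
  obtain ⟨g, hg, hgν⟩ := ν.exists_measurable_map_eq
  have hp : Measurable (Set.projIcc (0 : ℝ) 1 zero_le_one) := continuous_projIcc.measurable
  refine ⟨g ∘ Set.projIcc 0 1 zero_le_one, hg.comp hp, ?_⟩
  have h : stdSpace = (volume : Measure unitInterval).map Subtype.val :=
    (map_comap_subtype_coe measurableSet_Icc volume).symm
  rw [h, Measure.map_map (hg.comp hp) measurable_subtype_coe, ← hgν]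
  congr 1
  ext x
  simp

theorem ofReal_discreteCost {X : Type*} (x y : X) :
    ENNReal.ofReal (discreteCost x y) = {z : X × X | z.1 ≠ z.2}.indicator 1 (x, y) := by
  by_cases h : x = y <;> simp [discreteCost, h]

theorem measure_le_add_of_coupling {X : Type*} [MeasurableSpace X] {P Q : Measure X}
    {γ : Measure (X × X)} (h₁ : γ.map Prod.fst = P) (h₂ : γ.map Prod.snd = Q)
    {A : Set X} (hA : MeasurableSet A) :
    P A ≤ Q A + γ {z | z.1 ≠ z.2} := by
  rw [← h₁, ← h₂, Measure.map_apply measurable_fst hA, Measure.map_apply measurable_snd hA]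
  refine (measure_mono fun z hz => ?_).trans (measure_union_le _ _)
  by_cases h : z.1 = z.2
  · exact Or.inl (by simpa [h] using hz)
  · exact Or.inr h

section DiscreteCost

variable {X : Type*} [TopologicalSpace X] [PolishSpace X] [MeasurableSpace X] [BorelSpace X]

theorem measurableSet_offDiag : MeasurableSet {z : X × X | z.1 ≠ z.2} :=
  (measurableSet_eq_fun measurable_fst measurable_snd).compl

theorem lintegral_discreteCost {Ω : Type*} [MeasurableSpace Ω] (ν : Measure Ω) {f g : Ω → X}
    (hf : Measurable f) (hg : Measurable g) :
    ∫⁻ ω, ENNReal.ofReal (discreteCost (f ω) (g ω)) ∂ν = ν {ω | f ω ≠ g ω} := by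
  have h : MeasurableSet {ω | f ω ≠ g ω} := (measurableSet_eq_fun hf hg).compl
  simp_rw [ofReal_discreteCost]
  rw [← lintegral_indicator_one h]
  rfl

/-- A coupling on any standard Borel probability space can be transferred to `[0,1]`. -/
theorem exists_coupling_ratio_le {A Ω : Type*} [MeasurableSpace Ω] [StandardBorelSpace Ω]
    (ν : Measure Ω) [IsProbabilityMeasure ν] (P : A → Measure X) (Y : A → Ω → X)
    (hY : ∀ a, Measurable (Y a)) (hlaw : ∀ a, ν.map (Y a) = P a) (r : ℝ≥0∞) (hr : 1 ≤ r)
    (h : ∀ a b, ν {ω | Y a ω ≠ Y b ω} ≤ r * Cstar discreteCost (P a) (P b)) :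
    ∃ f, IsCoupling P f ∧ couplingRatio discreteCost P f ≤ r := by
  obtain ⟨φ, hφ, hφν⟩ := ν.exists_measurable_map_stdSpace_eq
  refine ⟨fun a => Y a ∘ φ, ⟨fun a => (hY a).comp hφ, fun a => ?_⟩, sInf_le ⟨hr, fun a b => ?_⟩⟩
  · rw [← Measure.map_map (hY a) hφ, hφν, hlaw]
  · rw [lintegral_discreteCost _ ((hY a).comp hφ) ((hY b).comp hφ)]
    refine le_trans (le_of_eq ?_) (h a b)
    have hm : MeasurableSet {ω | Y a ω ≠ Y b ω} := (measurableSet_eq_fun (hY a) (hY b)).compl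
    rw [← hφν, Measure.map_apply hφ hm]
    rfl

theorem le_mul_Cstar {P Q : Measure X} {r L : ℝ≥0∞} (hr : r ≠ 0) (hr' : r ≠ ∞)
    (h : ∀ γ : Measure (X × X), IsProbabilityMeasure γ → γ.map Prod.fst = P →
      γ.map Prod.snd = Q → L ≤ r * γ {z | z.1 ≠ z.2}) :
    L ≤ r * Cstar discreteCost P Q := by
  rw [mul_comm, ← ENNReal.div_le_iff hr hr']
  refine le_iInf₂ fun γ hγ => ?_
  rw [ENNReal.div_le_iff hr hr', mul_comm,
    lintegral_discreteCost γ measurable_fst measurable_snd]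
  exact h γ hγ.1 hγ.2.1 hγ.2.2

end DiscreteCost

theorem two_mul_le_card_ne {ι X : Type*} [Fintype ι] [DecidableEq X] {m : ℕ}
    (hι : Fintype.card ι = m + 1) (x : ι → X) (hx : ∃ i j, x i ≠ x j) :
    2 * m ≤ ∑ i, ∑ j, if x i ≠ x j then 1 else 0 := by
  obtain ⟨a, b, hab⟩ := hx
  have hsplit := Finset.card_filter_add_card_filter_not (s := (Finset.univ : Finset ι))
    (fun i => x i = x a)
  rw [Finset.card_univ, hι] at hsplit
  set S := Finset.univ.filter fun i => x i = x a with hS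
  set T := Finset.univ.filter fun i => ¬ x i = x a with hT
  have hSpos : 0 < S.card := Finset.card_pos.2 ⟨a, by simp [hS]⟩
  have hTpos : 0 < T.card := Finset.card_pos.2 ⟨b, by simpa [hT] using hab.symm⟩
  have h : ∀ i, (if x i = x a then T.card else S.card) ≤ ∑ j, if x i ≠ x j then 1 else 0 := by
    intro i
    rw [← Finset.sum_filter, Finset.sum_const, smul_eq_mul, mul_one]
    split_ifs with hi
    · refine Finset.card_le_card fun j hj => ?_
      simp only [hT, Finset.mem_filter, Finset.mem_univ, true_and] at hj ⊢
      rw [hi]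
      exact fun h => hj h.symm
    · refine Finset.card_le_card fun j hj => ?_
      simp only [hS, Finset.mem_filter, Finset.mem_univ, true_and] at hj ⊢
      rwa [hj]
  refine le_trans ?_ (Finset.sum_le_sum fun i _ => h i)
  rw [Finset.sum_ite, Finset.sum_const, Finset.sum_const, ← hS, ← hT,
    smul_eq_mul, smul_eq_mul]
  obtain ⟨p, hp⟩ := Nat.exists_eq_succ_of_ne_zero hSpos.ne'
  obtain ⟨q, hq⟩ := Nat.exists_eq_succ_of_ne_zero hTpos.ne'
  rw [hp, hq] at hsplit ⊢
  have : m = p + q + 1 := by lia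
  subst this
  simp only [Nat.succ_eq_add_one]
  nlinarith [Nat.zero_le (p * q)]

/-- The average of all measures of a finite family but the one with index `i`. -/
def averageErase {X ι : Type*} [MeasurableSpace X] [Fintype ι] [DecidableEq ι]
    (Q : ι → Measure X) (i : ι) : Measure X :=
  ((Fintype.card ι : ℝ≥0∞) - 1)⁻¹ • ∑ k ∈ Finset.univ.erase i, Q k

section LowerBound

variable {X : Type*} [MeasurableSpace X]
  {ι : Type*} [Fintype ι] [DecidableEq ι] {Q : ι → Measure X} [∀ i, IsProbabilityMeasure (Q i)]

theorem isProbabilityMeasure_averageErase (hι : 2 ≤ Fintype.card ι) (i : ι) :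
    IsProbabilityMeasure (averageErase Q i) := by
  refine ⟨?_⟩
  have h1 : ((Fintype.card ι - 1 : ℕ) : ℝ≥0∞) ≠ 0 := by
    simp only [ne_eq, Nat.cast_eq_zero]; lia
  simp only [averageErase, Measure.smul_apply, Measure.coe_finsetSum, Finset.sum_apply,
    measure_univ, Finset.sum_const, Finset.card_erase_of_mem (Finset.mem_univ i),
    Finset.card_univ, nsmul_eq_mul, mul_one, smul_eq_mul]
  have h2 : (Fintype.card ι : ℝ≥0∞) - 1 = (Fintype.card ι - 1 : ℕ) := by
    rw [ENNReal.natCast_sub, Nat.cast_one]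
  rw [h2]
  exact ENNReal.inv_mul_cancel h1 (ENNReal.natCast_ne_top _)

omit [∀ i, IsProbabilityMeasure (Q i)] in
theorem averageErase_absolutelyContinuous {μ : Measure X} (h : ∀ i, Q i ≪ μ) (i : ι) :
    averageErase Q i ≪ μ := by
  intro s hs
  simp [averageErase, Measure.smul_apply, h _ hs]

theorem Cstar_averageErase_le (hι : 2 ≤ Fintype.card ι) {i j : ι} (hij : i ≠ j) :
    Cstar discreteCost (averageErase Q i) (averageErase Q j)
      ≤ ((Fintype.card ι : ℝ≥0∞) - 1)⁻¹ := by
  set γ : Measure (X × X) := ((Fintype.card ι : ℝ≥0∞) - 1)⁻¹ •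
    (∑ k ∈ (Finset.univ.erase i).erase j, (Q k).map (fun x => (x, x)) + (Q j).prod (Q i)) with hγ
  have hd : Measurable fun x : X => (x, x) := measurable_id.prodMk measurable_id
  have hfst : γ.map Prod.fst = averageErase Q i := by
    rw [hγ, averageErase, Measure.map_smul, Measure.map_add _ _ measurable_fst,
      ← Measure.mapₗ_apply_of_measurable measurable_fst, map_sum]
    simp_rw [Measure.mapₗ_apply_of_measurable measurable_fst, Measure.map_map measurable_fst hd]
    rw [Measure.map_fst_prod, measure_univ, one_smul]
    have : (Prod.fst ∘ fun x : X => (x, x)) = id := rfl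
    simp_rw [this, Measure.map_id]
    rw [Finset.sum_erase_add _ _ (by simp [hij.symm])]
  have hsnd : γ.map Prod.snd = averageErase Q j := by
    rw [hγ, averageErase, Measure.map_smul, Measure.map_add _ _ measurable_snd,
      ← Measure.mapₗ_apply_of_measurable measurable_snd, map_sum]
    simp_rw [Measure.mapₗ_apply_of_measurable measurable_snd, Measure.map_map measurable_snd hd]
    rw [Measure.map_snd_prod, measure_univ, one_smul]
    have : (Prod.snd ∘ fun x : X => (x, x)) = id := rfl
    simp_rw [this, Measure.map_id]
    rw [Finset.erase_right_comm, Finset.sum_erase_add _ _ (by simp [hij])]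
  have hprob : IsProbabilityMeasure γ := by
    have := isProbabilityMeasure_averageErase (Q := Q) hι i
    rw [← hfst] at this
    exact (Measure.isProbabilityMeasure_map_iff measurable_fst.aemeasurable).1 this
  refine (iInf₂_le γ ⟨hprob, hfst, hsnd⟩).trans ?_
  rw [hγ, lintegral_smul_measure, lintegral_add_measure, lintegral_finsetSum_measure, smul_eq_mul]
  refine mul_le_of_le_one_right' ?_
  have h0 : ∀ k, ∫⁻ z, ENNReal.ofReal (discreteCost z.1 z.2) ∂(Q k).map (fun x => (x, x)) = 0 := by
    intro k
    refine le_antisymm ((lintegral_map_le _ _).trans ?_) zero_le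
    simp [discreteCost]
  rw [Finset.sum_eq_zero (fun k _ => h0 k), zero_add]
  calc ∫⁻ z, ENNReal.ofReal (discreteCost z.1 z.2) ∂(Q j).prod (Q i)
      ≤ ∫⁻ z, 1 ∂(Q j).prod (Q i) := by
        refine lintegral_mono fun z => ?_
        rw [discreteCost]
        split_ifs <;> simp
    _ = 1 := by simp

theorem le_couplingRatio_of_averageErase [TopologicalSpace X] [PolishSpace X] [BorelSpace X]
    {m : ℕ} (hι : Fintype.card ι = m + 1) (hm : 1 ≤ m) {U : ι → Set X}
    (hU : ∀ i, MeasurableSet (U i)) (hdisj : Pairwise fun i j => Disjoint (U i) (U j))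
    (hQU : ∀ i, Q i (U i)ᶜ = 0) {A : Type*} {P : A → Measure X} (a : ι → A)
    (ha : ∀ i, P (a i) = averageErase Q i) {f : A → ℝ → X} (hf : IsCoupling P f) :
    2 * (1 - ((m + 1 : ℕ) : ℝ≥0∞)⁻¹) ≤ couplingRatio discreteCost P f := by
  classical
  have hcard : (Fintype.card ι : ℝ≥0∞) - 1 = m := by rw [hι]; simp
  have hm0 : (m : ℝ≥0∞) ≠ 0 := by simp; lia
  refine le_sInf fun r ⟨_, hr⟩ => ?_
  have hstd : stdSpace Set.univ = 1 := by simp [stdSpace]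
  have hae : ∀ i, ∀ᵐ u ∂stdSpace, ∃ k ≠ i, f (a i) u ∈ U k := by
    intro i
    have hV : MeasurableSet (⋃ k ∈ {k | k ≠ i}, U k) :=
      MeasurableSet.biUnion (Set.to_countable _) fun k _ => hU k
    have h0 : stdSpace.map (f (a i)) (⋃ k ∈ {k | k ≠ i}, U k)ᶜ = 0 := by
      rw [hf.law, ha, averageErase, Measure.smul_apply, Measure.coe_finsetSum, Finset.sum_apply,
        Finset.sum_eq_zero, smul_zero]
      intro k hk
      refine measure_mono_null (Set.compl_subset_compl.2 ?_) (hQU k)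
      exact Set.subset_biUnion_of_mem (u := U) (Finset.ne_of_mem_erase hk)
    rw [Measure.map_apply (hf.measurable _) hV.compl] at h0
    filter_upwards [measure_eq_zero_iff_ae_notMem.1 h0] with u hu
    simpa using hu
  have hcount : ∀ᵐ u ∂stdSpace, (2 * m : ℝ≥0∞) ≤
      ∑ i, ∑ j, ENNReal.ofReal (discreteCost (f (a i) u) (f (a j) u)) := by
    filter_upwards [ae_all_iff.2 hae] with u hu
    have hne : ∃ i j, f (a i) u ≠ f (a j) u := by
      by_contra! hcon
      have : Nonempty ι := Fintype.card_pos_iff.1 (by lia)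
      obtain ⟨k, -, hk⟩ := hu (Classical.arbitrary ι)
      obtain ⟨l, hl, hl'⟩ := hu k
      rw [hcon k (Classical.arbitrary ι)] at hl'
      exact Set.disjoint_left.1 (hdisj hl) hl' hk
    have h := two_mul_le_card_ne hι (fun i => f (a i) u) hne
    have h' : ((2 * m : ℕ) : ℝ≥0∞) ≤
      ((∑ i, ∑ j, if f (a i) u ≠ f (a j) u then 1 else 0 : ℕ) : ℝ≥0∞) := Nat.cast_le.2 h
    push_cast at h'
    refine h'.trans (le_of_eq ?_)
    refine Finset.sum_congr rfl fun i _ => Finset.sum_congr rfl fun j _ => ?_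
    by_cases h : f (a i) u = f (a j) u <;> simp [discreteCost, h]
  have hmeas : ∀ i j, Measurable fun u =>
      ENNReal.ofReal (discreteCost (f (a i) u) (f (a j) u)) := by
    intro i j
    simp_rw [ofReal_discreteCost]
    exact (measurable_one.indicator measurableSet_offDiag).comp
      ((hf.measurable _).prodMk (hf.measurable _))
  have key : (2 * m : ℝ≥0∞) ≤ (m + 1) * r :=
    calc (2 * m : ℝ≥0∞) = ∫⁻ _, 2 * m ∂stdSpace := by rw [lintegral_const, hstd, mul_one]
      _ ≤ ∫⁻ u, ∑ i, ∑ j, ENNReal.ofReal (discreteCost (f (a i) u) (f (a j) u)) ∂stdSpace :=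
          lintegral_mono_ae hcount
      _ = ∑ i, ∑ j, ∫⁻ u, ENNReal.ofReal (discreteCost (f (a i) u) (f (a j) u)) ∂stdSpace := by
          rw [lintegral_finsetSum _ fun i _ => Finset.measurable_sum _ fun j _ => hmeas i j]
          refine Finset.sum_congr rfl fun i _ => ?_
          rw [lintegral_finsetSum _ fun j _ => hmeas i j]
      _ ≤ ∑ i : ι, ∑ j : ι, if j ∈ Finset.univ.erase i then r * (m : ℝ≥0∞)⁻¹ else 0 := by
          refine Finset.sum_le_sum fun i _ => Finset.sum_le_sum fun j _ => ?_
          split_ifs with h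
          · refine (hr (a i) (a j)).trans ?_
            rw [ha, ha, ← hcard]
            gcongr
            exact Cstar_averageErase_le (by lia) (Finset.ne_of_mem_erase h).symm
          · have : j = i := by simpa using h
            simp [this, discreteCost]
      _ = (m + 1) * r := by
          simp_rw [Finset.sum_ite_mem, Finset.univ_inter, Finset.sum_const,
            Finset.card_erase_of_mem (Finset.mem_univ _), Finset.card_univ, Finset.sum_const,
            Finset.card_univ, hι]
          simp only [Nat.add_sub_cancel, nsmul_eq_mul]
          rw [mul_left_comm (m : ℝ≥0∞), ENNReal.mul_inv_cancel hm0 (ENNReal.natCast_ne_top m),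
            mul_one]
          push_cast
          rfl
  have hm1 : ((m + 1 : ℕ) : ℝ≥0∞) ≠ 0 := by simp
  have hm1' : ((m + 1 : ℕ) : ℝ≥0∞) ≠ ∞ := ENNReal.natCast_ne_top _
  have heq : 1 - ((m + 1 : ℕ) : ℝ≥0∞)⁻¹ = m / ((m + 1 : ℕ) : ℝ≥0∞) := by
    have h1 : (1 : ℝ≥0∞) = ((m + 1 : ℕ) : ℝ≥0∞) / ((m + 1 : ℕ) : ℝ≥0∞) :=
      (ENNReal.div_self hm1 hm1').symm
    refine ENNReal.sub_eq_of_eq_add (ENNReal.inv_ne_top.2 hm1) ?_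
    nth_rw 1 [h1]
    rw [← one_div, ← ENNReal.add_div]
    push_cast
    rfl
  rw [heq, ← mul_div_assoc, ENNReal.div_le_iff hm1 hm1', mul_comm r]
  exact_mod_cast key

end LowerBound

/-- A countable family of random points `pt i`, the `i`-th one being present on the event `act i`,
with the void probabilities and a bound for the intensity of a Poisson point process. -/
structure IsPoissonCloud {Y Ω : Type*} [MeasurableSpace Y] [MeasurableSpace Ω] (Λ : Measure Y)
    (ν : Measure Ω) {ι : Type*} (act : ι → Set Ω) (pt : ι → Ω → Y) : Prop where
  measurableSet_act : ∀ i, MeasurableSet (act i)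
  measurable_pt : ∀ i, Measurable (pt i)
  void : ∀ B, MeasurableSet B → Λ B ≠ ∞ →
    ν {ω | ∀ i, ω ∈ act i → pt i ω ∉ B} = ENNReal.ofReal (Real.exp (-(Λ B).toReal))
  intensity_le : ∀ B, MeasurableSet B → ∑' i, ν (act i ∩ pt i ⁻¹' B) ≤ Λ B

open ProbabilityTheory in
theorem lintegral_poissonMeasure (m : NNReal) (g : ℕ → ℝ≥0∞) :
    ∫⁻ n, g n ∂poissonMeasure m =
      ∑' n, ENNReal.ofReal (Real.exp (-m) * m ^ n / n.factorial) * g n := by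
  rw [poissonMeasure, lintegral_sum_measure]
  simp_rw [lintegral_smul_measure, lintegral_dirac, smul_eq_mul]

open ProbabilityTheory in
theorem lintegral_pow_poissonMeasure (m : NNReal) {q : ℝ} (hq : 0 ≤ q) :
    ∫⁻ n, ENNReal.ofReal q ^ n ∂poissonMeasure m = ENNReal.ofReal (Real.exp (-(m * (1 - q)))) := by
  have h := (NormedSpace.expSeries_div_hasSum_exp (m * q : ℝ)).mul_left (Real.exp (-m))
  rw [← Real.exp_eq_exp_ℝ, ← Real.exp_add] at h
  rw [lintegral_poissonMeasure, show -(m * (1 - q)) = -m + m * q by ring, ← h.tsum_eq,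
    ENNReal.ofReal_tsum_of_nonneg (fun n => by positivity) h.summable]
  refine tsum_congr fun n => ?_
  rw [← ENNReal.ofReal_pow hq, ← ENNReal.ofReal_mul (by positivity)]
  congr 1
  rw [mul_pow]
  ring

open ProbabilityTheory in
theorem lintegral_id_poissonMeasure (m : NNReal) :
    ∫⁻ n, (n : ℝ≥0∞) ∂poissonMeasure m = m := by
  have h : HasSum (fun n : ℕ => (m : ℝ) * (Real.exp (-m) * m ^ n / n.factorial)) m := by
    simpa using (hasSum_one_poissonMeasure m).mul_left (m : ℝ)
  have key : ∀ n : ℕ, ENNReal.ofReal (Real.exp (-m) * m ^ (n + 1) / (n + 1).factorial) *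
      ((n + 1 : ℕ) : ℝ≥0∞) = ENNReal.ofReal (m * (Real.exp (-m) * m ^ n / n.factorial)) := by
    intro n
    rw [← ENNReal.ofReal_natCast, ← ENNReal.ofReal_mul (by positivity), Nat.factorial_succ]
    congr 1
    have h1 : ((n : ℝ) + 1) ≠ 0 := by positivity
    have h2 : (n.factorial : ℝ) ≠ 0 := by positivity
    push_cast
    field_simp
    ring
  rw [lintegral_poissonMeasure, tsum_eq_zero_add' ENNReal.summable]
  simp_rw [key]
  rw [← ENNReal.ofReal_tsum_of_nonneg (fun n => by positivity) h.summable, h.tsum_eq,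
    Nat.cast_zero, mul_zero, zero_add, ENNReal.ofReal_coe_nnreal]

open ProbabilityTheory in
theorem isPoissonCloud_of_finite {Y : Type*} [MeasurableSpace Y] (m : NNReal) (π : Measure Y)
    [IsProbabilityMeasure π] :
    IsPoissonCloud (m • π) ((poissonMeasure m).prod (Measure.infinitePi fun _ : ℕ => π))
      (fun j => {ω | j < ω.1}) (fun j ω => ω.2 j) where
  measurableSet_act j := measurable_fst (MeasurableSet.of_discrete (s := {n : ℕ | j < n}))
  measurable_pt j := by fun_prop
  void B hB _ := by
    have hm : MeasurableSet {ω : ℕ × (ℕ → Y) | ∀ j, j < ω.1 → ω.2 j ∉ B} := by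
      have : {ω : ℕ × (ℕ → Y) | ∀ j, j < ω.1 → ω.2 j ∉ B} =
          ⋂ j, ({ω : ℕ × (ℕ → Y) | j < ω.1}ᶜ ∪ ((fun ω => ω.2 j) ⁻¹' B)ᶜ) := by
        ext ω; simp [imp_iff_not_or]
      rw [this]
      exact MeasurableSet.iInter fun j =>
        (measurable_fst (MeasurableSet.of_discrete (s := {n : ℕ | j < n}))).compl.union
          ((show Measurable fun ω : ℕ × (ℕ → Y) => ω.2 j by fun_prop) hB).compl
    simp only [Set.mem_ofPred_eq]
    rw [Measure.prod_apply hm]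
    have h : ∀ n : ℕ, (Measure.infinitePi fun _ : ℕ => π)
        (Prod.mk n ⁻¹' {ω : ℕ × (ℕ → Y) | ∀ j, j < ω.1 → ω.2 j ∉ B}) =
        ENNReal.ofReal (1 - π.real B) ^ n := by
      intro n
      have : Prod.mk n ⁻¹' {ω : ℕ × (ℕ → Y) | ∀ j, j < ω.1 → ω.2 j ∉ B} =
          Set.pi (Finset.range n : Set ℕ) fun _ => Bᶜ := by
        ext; simp
      rw [this, Measure.infinitePi_pi _ fun _ _ => hB.compl, Finset.prod_const, Finset.card_range,
        ← probReal_compl_eq_one_sub hB, ofReal_measureReal]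
    simp_rw [h]
    rw [lintegral_pow_poissonMeasure _ (by simp)]
    have h2 : (m • π) B = m * π B := rfl
    rw [h2, ENNReal.toReal_mul, ENNReal.coe_toReal, _root_.sub_sub_cancel, measureReal_def]
  intensity_le B hB := by
    have h : ∀ j, ((poissonMeasure m).prod (Measure.infinitePi fun _ : ℕ => π))
        ({ω | j < ω.1} ∩ (fun ω => ω.2 j) ⁻¹' B) = poissonMeasure m {n | j < n} * π B := by
      intro j
      have : ({ω : ℕ × (ℕ → Y) | j < ω.1} ∩ (fun ω => ω.2 j) ⁻¹' B) =
        {n | j < n} ×ˢ ((fun y : ℕ → Y => y j) ⁻¹' B) := by ext; simp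
      rw [this, Measure.prod_prod, ← Measure.map_apply (by fun_prop) hB,
        Measure.infinitePi_map_eval]
    simp_rw [h]
    rw [ENNReal.tsum_mul_right]
    have h2 : ∑' j, poissonMeasure m {n | j < n} = m := by
      rw [← lintegral_id_poissonMeasure]
      simp_rw [← fun j => lintegral_indicator_one (μ := poissonMeasure m)
        (MeasurableSet.of_discrete (s := {n : ℕ | j < n}))]
      rw [← lintegral_tsum fun j => by fun_prop]
      refine lintegral_congr fun n => ?_
      rw [tsum_eq_sum (s := Finset.range n) (by simp +contextual [Set.indicator]),
        Finset.sum_congr rfl (g := fun _ => 1) (by simp +contextual [Set.indicator])]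
      simp
    rw [h2]
    rfl

theorem exists_isPoissonCloud {Y : Type*} [MeasurableSpace Y] [StandardBorelSpace Y] [Nonempty Y]
    (Λ : Measure Y) [SFinite Λ] :
    ∃ ν : Measure (ℕ → ℕ × (ℕ → Y)), IsProbabilityMeasure ν ∧
      ∃ (act : ℕ → Set (ℕ → ℕ × (ℕ → Y))) (pt : ℕ → (ℕ → ℕ × (ℕ → Y)) → Y),
        IsPoissonCloud Λ ν act pt := by
  have hdec : ∀ n, ∃ (m : NNReal) (π : Measure Y), IsProbabilityMeasure π ∧
      sfiniteSeq Λ n = m • π := by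
    intro n
    let κ : FiniteMeasure Y := ⟨sfiniteSeq Λ n, inferInstance⟩
    refine ⟨κ.mass, κ.normalize, inferInstance, ?_⟩
    exact congrArg Subtype.val κ.self_eq_mass_smul_normalize
  choose m π hπ hmπ using hdec
  have hcell := fun n => isPoissonCloud_of_finite (m n) (π n)
  simp_rw [← hmπ] at hcell
  set ν : ∀ n, Measure (ℕ × (ℕ → Y)) := fun n =>
    (ProbabilityTheory.poissonMeasure (m n)).prod (Measure.infinitePi fun _ : ℕ => π n) with hν
  have hΛ : ∀ B, MeasurableSet B → Λ B = ∑' n, sfiniteSeq Λ n B := by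
    intro B hB
    conv_lhs => rw [← sum_sfiniteSeq Λ]
    rw [Measure.sum_apply _ hB]
  refine ⟨Measure.infinitePi ν, inferInstance, fun i => {ω | i.unpair.2 < (ω i.unpair.1).1},
    fun i ω => (ω i.unpair.1).2 i.unpair.2, fun i => ?_, fun i => by fun_prop, fun B hB hfin => ?_,
    fun B hB => ?_⟩
  · exact (show Measurable fun ω : ℕ → ℕ × (ℕ → Y) => (ω i.unpair.1).1 by fun_prop)
      (MeasurableSet.of_discrete (s := {n : ℕ | i.unpair.2 < n}))
  · have hset : {ω : ℕ → ℕ × (ℕ → Y) | ∀ i : ℕ, ω ∈ {ω : ℕ → ℕ × (ℕ → Y) |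
        i.unpair.2 < (ω i.unpair.1).1} → (ω i.unpair.1).2 i.unpair.2 ∉ B} =
        Set.univ.pi fun _ => {ω : ℕ × (ℕ → Y) | ∀ j, ω ∈ {ω : ℕ × (ℕ → Y) | j < ω.1} →
          ω.2 j ∉ B} := by
      ext ω
      simp only [Set.mem_ofPred_eq, Set.mem_pi, Set.mem_univ, true_imp_iff]
      refine ⟨fun h n j => by simpa using h (Nat.pair n j), fun h i => h _ _⟩
    have hmeas : ∀ n : ℕ, MeasurableSet {ω : ℕ × (ℕ → Y) | ∀ j,
        ω ∈ {ω : ℕ × (ℕ → Y) | j < ω.1} → ω.2 j ∉ B} := by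
      intro n
      have : {ω : ℕ × (ℕ → Y) | ∀ j, ω ∈ {ω : ℕ × (ℕ → Y) | j < ω.1} → ω.2 j ∉ B} =
          ⋂ j, ({ω : ℕ × (ℕ → Y) | j < ω.1}ᶜ ∪ ((fun ω => ω.2 j) ⁻¹' B)ᶜ) := by
        ext ω; simp [imp_iff_not_or]
      rw [this]
      exact MeasurableSet.iInter fun j => ((hcell n).measurableSet_act j).compl.union
        ((hcell n).measurable_pt j hB).compl
    have hfin' : ∑' n, sfiniteSeq Λ n B ≠ ∞ := hΛ B hB ▸ hfin
    rw [hset, Measure.infinitePi_pi_univ _ hmeas]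
    rw [tprod_congr fun n => (hcell n).void B hB (ENNReal.ne_top_of_tsum_ne_top hfin' n), hΛ B hB,
      ENNReal.tsum_toReal_eq (ENNReal.ne_top_of_tsum_ne_top hfin')]
    have hs := (ENNReal.summable_toReal hfin').hasSum.neg.rexp
    refine HasProd.tprod_eq ?_
    refine ((ENNReal.continuous_ofReal.tendsto _).comp hs).congr fun s => ?_
    simp only [Function.comp]
    rw [ENNReal.ofReal_prod_of_nonneg fun _ _ => by positivity]
  · have h : ∀ i : ℕ, Measure.infinitePi ν ({ω | i.unpair.2 < (ω i.unpair.1).1} ∩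
        (fun ω => (ω i.unpair.1).2 i.unpair.2) ⁻¹' B) =
        ν i.unpair.1 ({ω | i.unpair.2 < ω.1} ∩ (fun ω => ω.2 i.unpair.2) ⁻¹' B) := by
      intro i
      conv_rhs => rw [← Measure.infinitePi_map_eval ν i.unpair.1]
      rw [Measure.map_apply (by fun_prop) (((hcell i.unpair.1).measurableSet_act _).inter
        ((hcell i.unpair.1).measurable_pt _ hB))]
      rfl
    simp_rw [h]
    refine (Nat.pairEquiv.symm.tsum_eq (f := fun p : ℕ × ℕ =>
      ν p.1 ({ω | p.2 < ω.1} ∩ (fun ω => ω.2 p.2) ⁻¹' B))).trans_le ?_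
    rw [hΛ B hB, ENNReal.tsum_prod (f := fun n j => ν n ({ω | j < ω.1} ∩ (fun ω => ω.2 j) ⁻¹' B))]
    exact ENNReal.tsum_le_tsum fun n => (hcell n).intensity_le B hB

theorem measurableSet_ofReal_lt (r : NNReal) : MeasurableSet {τ : ℝ | ENNReal.ofReal τ < r} :=
  ENNReal.measurable_ofReal measurableSet_Iio

theorem volume_Ici_ofReal_lt (r : NNReal) :
    volume.restrict (Set.Ici (0 : ℝ)) {τ : ℝ | ENNReal.ofReal τ < r} = r := by
  rw [Measure.restrict_apply (measurableSet_ofReal_lt r)]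
  have : {τ : ℝ | ENNReal.ofReal τ < r} ∩ Set.Ici 0 = Set.Ico 0 (r : ℝ) := by
    ext τ
    simp only [Set.mem_inter_iff, Set.mem_ofPred_eq, Set.mem_Ici, Set.mem_Ico]
    rw [and_comm]
    refine and_congr_right fun h => ?_
    rw [ENNReal.ofReal_lt_iff_lt_toReal h ENNReal.coe_ne_top, ENNReal.coe_toReal]
  rw [this, Real.volume_Ico]
  simp

section FirstPoint

variable {Z Ω : Type*}

/-- The first time at which a point of a cloud in `Z × ℝ` has its location in `A`. -/
def arrival (act : ℕ → Set Ω) (pt : ℕ → Ω → Z × ℝ) (A : Set Z) (ω : Ω) : ℝ≥0∞ :=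
  ⨅ i, ⨅ (_ : ω ∈ act i ∧ (pt i ω).1 ∈ A), ENNReal.ofReal (pt i ω).2

variable {act : ℕ → Set Ω} {pt : ℕ → Ω → Z × ℝ} {A B F G H : Set Z}

theorem le_arrival_iff {s : ℝ≥0∞} {ω : Ω} :
    s ≤ arrival act pt A ω ↔
      ∀ i, ω ∈ act i → (pt i ω).1 ∈ A → s ≤ ENNReal.ofReal (pt i ω).2 := by
  simp [arrival, le_iInf_iff]

theorem arrival_anti (h : A ⊆ B) (ω : Ω) : arrival act pt B ω ≤ arrival act pt A ω :=
  le_arrival_iff.2 fun i hi hA => le_arrival_iff.1 le_rfl i hi (h hA)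

theorem min_arrival_le (h : F ⊆ A ∪ B) (ω : Ω) :
    min (arrival act pt A ω) (arrival act pt B ω) ≤ arrival act pt F ω :=
  le_arrival_iff.2 fun i hi hF => by
    rcases h hF with hA | hB
    · exact (min_le_left _ _).trans (le_arrival_iff.1 le_rfl i hi hA)
    · exact (min_le_right _ _).trans (le_arrival_iff.1 le_rfl i hi hB)

/-- The `i`-th point of the cloud is located in `H` and is the first one to arrive there. -/
def isFirst (act : ℕ → Set Ω) (pt : ℕ → Ω → Z × ℝ) (H : Set Z) (i : ℕ) : Set Ω :=
  {ω | (ω ∈ act i ∧ (pt i ω).1 ∈ H) ∧ ENNReal.ofReal (pt i ω).2 = arrival act pt H ω}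

/-- The location of the first point of the cloud to arrive in `H`. -/
def firstPoint (act : ℕ → Set Ω) (pt : ℕ → Ω → Z × ℝ) (H : Set Z) (ω : Ω) : Z :=
  (pt (sInf {i | ω ∈ isFirst act pt H i}) ω).1

theorem isFirst_iff_of_arrival_lt (hAF : A ⊆ F) (hF : F ⊆ A ∪ B) {ω : Ω}
    (h : arrival act pt A ω < arrival act pt B ω) (i : ℕ) :
    ω ∈ isFirst act pt F i ↔ ω ∈ isFirst act pt A i := by
  have he : arrival act pt F ω = arrival act pt A ω :=
    le_antisymm (arrival_anti hAF ω) ((min_eq_left h.le).symm.trans_le (min_arrival_le hF ω))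
  simp only [isFirst, Set.mem_ofPred_eq, he]
  refine ⟨fun ⟨⟨h1, h2⟩, h3⟩ => ⟨⟨h1, (hF h2).resolve_right fun hB => ?_⟩, h3⟩,
    fun ⟨⟨h1, h2⟩, h3⟩ => ⟨⟨h1, hAF h2⟩, h3⟩⟩
  exact (h3 ▸ h).not_ge (le_arrival_iff.1 le_rfl i h1 hB)

theorem firstPoint_eq_of_arrival_lt (hAF : A ⊆ F) (hF : F ⊆ A ∪ B) {ω : Ω}
    (h : arrival act pt A ω < arrival act pt B ω) :
    firstPoint act pt F ω = firstPoint act pt A ω := by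
  simp only [firstPoint, isFirst_iff_of_arrival_lt hAF hF h]

theorem firstPoint_mem {ω : Ω} (h : ∃ i, ω ∈ isFirst act pt H i) : firstPoint act pt H ω ∈ H :=
  (Nat.sInf_mem (s := {i | ω ∈ isFirst act pt H i}) h).1.2

variable [MeasurableSpace Z] [MeasurableSpace Ω] {ρ : Measure Z} {ν : Measure Ω}

section

variable (hc : IsPoissonCloud (ρ.prod (volume.restrict (Set.Ici (0 : ℝ)))) ν act pt)

include hc

theorem IsPoissonCloud.measurable_arrival (hA : MeasurableSet A) :
    Measurable (arrival act pt A) := by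
  refine measurable_of_Ici fun s => ?_
  have : arrival act pt A ⁻¹' Set.Ici s = ⋂ i, ((act i)ᶜ ∪ ((fun ω => (pt i ω).1) ⁻¹' A)ᶜ ∪
      (fun ω => ENNReal.ofReal (pt i ω).2) ⁻¹' Set.Ici s) := by
    ext ω
    simp [le_arrival_iff, imp_iff_not_or, or_assoc]
  rw [this]
  have hp := hc.measurable_pt
  exact MeasurableSet.iInter fun i => ((hc.measurableSet_act i).compl.union
    ((measurable_fst.comp (hp i)) hA).compl).union
      ((ENNReal.measurable_ofReal.comp (measurable_snd.comp (hp i))) measurableSet_Ici)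

theorem IsPoissonCloud.measurableSet_isFirst (hH : MeasurableSet H) (i : ℕ) :
    MeasurableSet (isFirst act pt H i) :=
  ((hc.measurableSet_act i).inter ((measurable_fst.comp (hc.measurable_pt i)) hH)).inter
    (measurableSet_eq_fun (ENNReal.measurable_ofReal.comp (measurable_snd.comp
      (hc.measurable_pt i))) (hc.measurable_arrival hH))

theorem IsPoissonCloud.measurable_firstPoint (hH : MeasurableSet H) :
    Measurable (firstPoint act pt H) := by
  classical
  have hex : ∀ ω, ∃ n, ω ∈ isFirst act pt H n ∨ ∀ k, ω ∉ isFirst act pt H k := by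
    intro ω
    by_cases h : ∃ n, ω ∈ isFirst act pt H n
    · exact h.imp fun n hn => Or.inl hn
    · exact ⟨0, Or.inr fun k hk => h ⟨k, hk⟩⟩
  have hm := hc.measurableSet_isFirst hH
  have hp : ∀ n, MeasurableSet {ω | ω ∈ isFirst act pt H n ∨ ∀ k, ω ∉ isFirst act pt H k} := by
    intro n
    convert (hm n).union (MeasurableSet.iInter fun k => (hm k).compl) using 1
    ext ω
    simp
  convert Measurable.find (f := fun n ω => (pt n ω).1)
    (fun n => measurable_fst.comp (hc.measurable_pt n)) hp hex using 1
  · funext ω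
    have : Nat.find (hex ω) = sInf {i | ω ∈ isFirst act pt H i} := by
      by_cases h : ∃ n, ω ∈ isFirst act pt H n
      · have hn : ¬ ∀ k, ω ∉ isFirst act pt H k := by simpa using h
        rw [Nat.sInf_def (s := {i | ω ∈ isFirst act pt H i}) h]
        simp [hn]
      · have hn : ∀ k, ω ∉ isFirst act pt H k := by simpa using h
        simp [hn]
    simp only [firstPoint, this]

theorem IsPoissonCloud.measure_le_arrival (hA : MeasurableSet A) (hB : MeasurableSet B)
    (hAB : Disjoint A B) (hA' : ρ A ≠ ∞) (hB' : ρ B ≠ ∞) (s t : NNReal) :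
    ν {ω | (s : ℝ≥0∞) ≤ arrival act pt A ω ∧ (t : ℝ≥0∞) ≤ arrival act pt B ω} =
      ENNReal.ofReal (Real.exp (-(ρ.real A * s + ρ.real B * t))) := by
  have hI := measurableSet_ofReal_lt
  have h := hc.void (A ×ˢ {τ : ℝ | ENNReal.ofReal τ < s} ∪ B ×ˢ {τ : ℝ | ENNReal.ofReal τ < t})
    ((hA.prod (hI s)).union (hB.prod (hI t)))
  rw [measure_union (Set.disjoint_prod.2 (Or.inl hAB)) (hB.prod (hI t)), Measure.prod_prod,
    Measure.prod_prod, volume_Ici_ofReal_lt, volume_Ici_ofReal_lt] at h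
  have h1 : ρ A * s ≠ ∞ := ENNReal.mul_ne_top hA' ENNReal.coe_ne_top
  have h2 : ρ B * t ≠ ∞ := ENNReal.mul_ne_top hB' ENNReal.coe_ne_top
  rw [ENNReal.toReal_add h1 h2, ENNReal.toReal_mul, ENNReal.toReal_mul] at h
  refine Eq.trans ?_ (h (ENNReal.add_ne_top.2 ⟨h1, h2⟩))
  congr 1
  ext ω
  simp only [Set.mem_ofPred_eq, le_arrival_iff, Set.mem_union, Set.mem_prod, not_or, not_and,
    not_lt]
  exact ⟨fun h i hi => ⟨h.1 i hi, h.2 i hi⟩,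
    fun h => ⟨fun i hi => (h i hi).1, fun i hi => (h i hi).2⟩⟩

theorem IsPoissonCloud.le_measure_arrival_lt [IsProbabilityMeasure ν]
    (hA : MeasurableSet A) (hB : MeasurableSet B)
    (hAB : Disjoint A B) (hA' : ρ A ≠ ∞) (hB' : ρ B ≠ ∞) (hpos : 0 < ρ.real A + ρ.real B) :
    ENNReal.ofReal (ρ.real A / (ρ.real A + ρ.real B)) ≤
      ν {ω | arrival act pt A ω < arrival act pt B ω} := by
  set a := ρ.real A with ha
  set b := ρ.real B with hb
  have ha0 : 0 ≤ a := measureReal_nonneg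
  have key : ∀ ε : ℝ, 0 < ε → ENNReal.ofReal (a / (a + b) * Real.exp (-((a + b) * ε))) ≤
      ν {ω | arrival act pt A ω < arrival act pt B ω} := by
    intro ε hε
    lift ε to NNReal using hε.le
    set q := Real.exp (-((a + b) * ε)) with hq
    have hq1 : q < 1 := Real.exp_lt_one_iff.2 (by simp only [Left.neg_neg_iff]; positivity)
    have hq0 : 0 < q := Real.exp_pos _
    let T : NNReal → NNReal → Set Ω := fun s t =>
      {ω | (s : ℝ≥0∞) ≤ arrival act pt A ω ∧ (t : ℝ≥0∞) ≤ arrival act pt B ω}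
    have hT : ∀ s t, MeasurableSet (T s t) := fun s t =>
      ((hc.measurable_arrival hA) measurableSet_Ici).inter
        ((hc.measurable_arrival hB) measurableSet_Ici)
    let E : ℕ → Set Ω := fun k =>
      T (k * ε) ((k + 1 : ℕ) * ε) \ T ((k + 1 : ℕ) * ε) ((k + 1 : ℕ) * ε)
    have hE : ∀ k, ν (E k) = ENNReal.ofReal (q ^ k * (Real.exp (-(b * ε)) - q)) := by
      intro k
      have hsub : T ((k + 1 : ℕ) * ε) ((k + 1 : ℕ) * ε) ⊆ T (k * ε) ((k + 1 : ℕ) * ε) := by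
        intro ω hω
        refine ⟨le_trans ?_ hω.1, hω.2⟩
        gcongr
        simp
      rw [measure_sdiff hsub (hT _ _).nullMeasurableSet (measure_ne_top _ _),
        hc.measure_le_arrival hA hB hAB hA' hB', hc.measure_le_arrival hA hB hAB hA' hB',
        ← ENNReal.ofReal_sub _ (Real.exp_pos _).le]
      congr 1
      rw [mul_sub, hq, ← Real.exp_nat_mul, ← Real.exp_add, ← Real.exp_add]
      push_cast
      congr 2 <;> ring
    have hmem : ∀ k ω, ω ∈ E k → (k * ε : NNReal) ≤ arrival act pt A ω ∧
        arrival act pt A ω < ((k + 1 : ℕ) * ε : NNReal) ∧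
        ((k + 1 : ℕ) * ε : NNReal) ≤ arrival act pt B ω := by
      intro k ω h
      exact ⟨h.1.1, lt_of_not_ge fun h' => h.2 ⟨h', h.1.2⟩, h.1.2⟩
    have hdisj : Pairwise (Function.onFun Disjoint E) := by
      refine (pairwise_disjoint_on E).2 fun k l hkl => Set.disjoint_left.2 fun ω hk hl => ?_
      have h1 := (hmem k ω hk).2.1
      have h2 := (hmem l ω hl).1
      refine (h1.trans_le ((?_ : _ ≤ _).trans h2)).false
      gcongr
      exact_mod_cast hkl
    have hsub : ⋃ k, E k ⊆ {ω | arrival act pt A ω < arrival act pt B ω} :=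
      Set.iUnion_subset fun k ω h => (hmem k ω h).2.1.trans_le (hmem k ω h).2.2
    refine le_trans ?_ (measure_mono hsub)
    rw [measure_iUnion hdisj fun k => (hT _ _).diff (hT _ _)]
    simp_rw [hE]
    have hbq : q ≤ Real.exp (-(b * ε)) := Real.exp_le_exp.2 (by nlinarith [mul_nonneg ha0 hε.le])
    have hgeo := (hasSum_geometric_of_lt_one hq0.le hq1).mul_right (Real.exp (-(b * ε)) - q)
    rw [← ENNReal.ofReal_tsum_of_nonneg (fun k => mul_nonneg (by positivity) (sub_nonneg.2 hbq))
      hgeo.summable, hgeo.tsum_eq]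
    refine ENNReal.ofReal_le_ofReal ?_
    have h1 : q * (a * ε) ≤ Real.exp (-(b * ε)) - q := by
      have : Real.exp (-(b * ε)) = q * Real.exp (a * ε) := by
        rw [hq, ← Real.exp_add]; congr 1; ring
      rw [this]
      nlinarith [Real.add_one_le_exp (a * ε)]
    have h2 : 1 - q ≤ (a + b) * ε := by
      have := Real.add_one_le_exp (-((a + b) * ε)); linarith
    calc a / (a + b) * q = ((a + b) * ε)⁻¹ * (q * (a * ε)) := by field_simp
      _ ≤ (1 - q)⁻¹ * (Real.exp (-(b * ε)) - q) := by
        gcongr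
  have hlim : Filter.Tendsto (fun ε : ℝ => ENNReal.ofReal (a / (a + b) * Real.exp (-((a + b) * ε))))
      (nhdsWithin 0 (Set.Ioi 0)) (nhds (ENNReal.ofReal (a / (a + b)))) := by
    have : Continuous fun ε : ℝ => ENNReal.ofReal (a / (a + b) * Real.exp (-((a + b) * ε))) :=
      ENNReal.continuous_ofReal.comp (by fun_prop)
    simpa using (this.tendsto 0).mono_left nhdsWithin_le_nhds
  exact le_of_tendsto hlim (Filter.eventually_of_mem self_mem_nhdsWithin key)

theorem IsPoissonCloud.ae_exists_isFirst (hH : MeasurableSet H) (h0 : ρ H ≠ 0) (h1 : ρ H ≠ ∞) :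
    ∀ᵐ ω ∂ν, ∃ i, ω ∈ isFirst act pt H i := by
  have hfin : ∀ᵐ ω ∂ν, arrival act pt H ω < ∞ := by
    rw [ae_iff]
    have hle : ∀ n : ℕ, ν {ω | ¬ arrival act pt H ω < ∞} ≤
        ENNReal.ofReal (Real.exp (-(ρ.real H * n))) := by
      intro n
      have h := hc.measure_le_arrival hH MeasurableSet.empty (Set.disjoint_empty H) h1 (by simp) n 0
      rw [measureReal_empty, zero_mul, add_zero] at h
      refine le_trans (measure_mono fun ω hω => ?_) h.le
      simp only [Set.mem_ofPred_eq, not_lt, top_le_iff] at hω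
      simp [hω]
    have hpos : 0 < ρ.real H := ENNReal.toReal_pos h0 h1
    have hlim : Filter.Tendsto (fun n : ℕ => ENNReal.ofReal (Real.exp (-(ρ.real H * n))))
        Filter.atTop (nhds 0) := by
      rw [← ENNReal.ofReal_zero]
      refine (ENNReal.continuous_ofReal.tendsto _).comp
        (Real.tendsto_exp_neg_atTop_nhds_zero.comp ?_)
      exact tendsto_natCast_atTop_atTop.const_mul_atTop hpos
    exact le_antisymm (ge_of_tendsto' hlim hle) bot_le
  have hloc : ∀ᵐ ω ∂ν, ∀ n : ℕ, {i | ω ∈ act i ∩ pt i ⁻¹'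
      (H ×ˢ {τ : ℝ | ENNReal.ofReal τ < (n : NNReal)})}.Finite := by
    refine ae_all_iff.2 fun n => ae_finite_setOfPred_mem ?_
    refine ne_top_of_le_ne_top ?_ (hc.intensity_le _ (hH.prod (measurableSet_ofReal_lt n)))
    rw [Measure.prod_prod, volume_Ici_ofReal_lt]
    exact ENNReal.mul_ne_top h1 ENNReal.coe_ne_top
  filter_upwards [hfin, hloc] with ω hω hl
  obtain ⟨n, hn⟩ := ENNReal.exists_nat_gt hω.ne
  have hne : {i | ω ∈ act i ∩ pt i ⁻¹'
      (H ×ˢ {τ : ℝ | ENNReal.ofReal τ < (n : NNReal)})}.Nonempty := by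
    simp only [arrival, iInf_lt_iff] at hn
    obtain ⟨i, hi, hlt⟩ := hn
    exact ⟨i, hi.1, hi.2, by simpa using hlt⟩
  obtain ⟨i, hi, hmin⟩ := Set.exists_min_image _ (fun i => ENNReal.ofReal (pt i ω).2) (hl n) hne
  refine ⟨i, ⟨hi.1, hi.2.1⟩, le_antisymm (le_arrival_iff.2 fun j hj hjH => ?_)
    (le_arrival_iff.1 le_rfl i hi.1 hi.2.1)⟩
  by_cases hjn : ENNReal.ofReal (pt j ω).2 < (n : NNReal)
  · exact hmin j ⟨hj, hjH, hjn⟩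
  · exact (show _ < _ from hi.2.2).le.trans (not_lt.1 hjn)

theorem IsPoissonCloud.le_measure_firstPoint [IsProbabilityMeasure ν] (hA : MeasurableSet A)
    (hH : MeasurableSet H) (hAH : A ⊆ H) (h1 : ρ H = 1) :
    ρ A ≤ ν {ω | firstPoint act pt H ω ∈ A} := by
  rcases eq_or_ne (ρ A) 0 with h0 | h0
  · simp [h0]
  have hA' : ρ A ≠ ∞ := ne_top_of_le_ne_top (by simp [h1]) (measure_mono hAH)
  have hB' : ρ (H \ A) ≠ ∞ := ne_top_of_le_ne_top (by simp [h1]) (measure_mono Set.sdiff_subset)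
  have hsum : ρ.real A + ρ.real (H \ A) = 1 := by
    have h := measure_sdiff_add_inter (μ := ρ) H hA
    rw [Set.inter_eq_right.2 hAH, add_comm, h1] at h
    rw [measureReal_def, measureReal_def, ← ENNReal.toReal_add hA' hB', h, ENNReal.toReal_one]
  have h := hc.le_measure_arrival_lt hA (hH.diff hA) Set.disjoint_sdiff_right hA' hB'
    (by simp [hsum])
  rw [hsum, div_one, ofReal_measureReal] at h
  refine h.trans (measure_mono_ae ?_)
  filter_upwards [hc.ae_exists_isFirst hA h0 hA'] with ω hω hlt
  show firstPoint act pt H ω ∈ A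
  rw [firstPoint_eq_of_arrival_lt hAH (by simp) hlt]
  exact firstPoint_mem hω

theorem IsPoissonCloud.map_firstPoint [IsProbabilityMeasure ν] (hH : MeasurableSet H)
    (h1 : ρ H = 1) : ν.map (firstPoint act pt H) = ρ.restrict H := by
  have hm := hc.measurable_firstPoint hH
  have : IsProbabilityMeasure (ν.map (firstPoint act pt H)) :=
    Measure.isProbabilityMeasure_map hm.aemeasurable
  have : IsProbabilityMeasure (ρ.restrict H) := ⟨by simp [h1]⟩
  refine (Measure.eq_of_le_of_isProbabilityMeasure (Measure.le_iff.2 fun A hA => ?_)).symm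
  rw [Measure.map_apply hm hA, Measure.restrict_apply hA]
  exact (hc.le_measure_firstPoint (hA.inter hH) hH Set.inter_subset_right h1).trans
    (measure_mono fun ω hω => hω.1)

theorem IsPoissonCloud.measure_firstPoint_ne_le [IsProbabilityMeasure ν] (hF : MeasurableSet F)
    (hG : MeasurableSet G) (hF1 : ρ F = 1) (hG1 : ρ G = 1) :
    ν {ω | firstPoint act pt F ω ≠ firstPoint act pt G ω} ≤ ρ (F \ G) + ρ (G \ F) := by
  set A := F ∩ G with hA
  set B := F \ G ∪ G \ F with hB
  have hAm : MeasurableSet A := hF.inter hG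
  have hBm : MeasurableSet B := (hF.diff hG).union (hG.diff hF)
  have hA' : ρ A ≠ ∞ := ne_top_of_le_ne_top (by simp [hF1]) (measure_mono Set.inter_subset_left)
  have hB2 : ρ B ≤ ρ (F \ G) + ρ (G \ F) := measure_union_le _ _
  have hB' : ρ B ≠ ∞ := by
    refine ne_top_of_le_ne_top (ENNReal.add_ne_top.2 ⟨?_, ?_⟩) hB2
    · exact ne_top_of_le_ne_top (by simp [hF1]) (measure_mono Set.sdiff_subset)
    · exact ne_top_of_le_ne_top (by simp [hG1]) (measure_mono Set.sdiff_subset)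
  have hAF : A ⊆ F := Set.inter_subset_left
  have hAG : A ⊆ G := Set.inter_subset_right
  have hFAB : F ⊆ A ∪ B := fun z hz => by by_cases h : z ∈ G <;> simp [hA, hB, hz, h]
  have hGAB : G ⊆ A ∪ B := fun z hz => by by_cases h : z ∈ F <;> simp [hA, hB, hz, h]
  have hAB : Disjoint A B := Set.disjoint_left.2 fun z hz => by simp [hB, hz.1, hz.2]
  have hsum : 1 ≤ ρ.real A + ρ.real B := by
    have h : ρ.real F ≤ ρ.real A + ρ.real B :=
      (measureReal_mono hFAB (measure_union_lt_top hA'.lt_top hB'.lt_top).ne).trans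
        (measureReal_union_le _ _)
    rwa [measureReal_def, hF1, ENNReal.toReal_one] at h
  have h := hc.le_measure_arrival_lt hAm hBm hAB hA' hB' (by linarith)
  refine le_trans ?_ hB2
  have hsub : {ω | firstPoint act pt F ω ≠ firstPoint act pt G ω} ⊆
      {ω | arrival act pt A ω < arrival act pt B ω}ᶜ := fun ω hω hlt =>
    hω ((firstPoint_eq_of_arrival_lt hAF hFAB hlt).trans
      (firstPoint_eq_of_arrival_lt hAG hGAB hlt).symm)
  have hm : MeasurableSet {ω | arrival act pt A ω < arrival act pt B ω} :=
    measurableSet_lt (hc.measurable_arrival hAm) (hc.measurable_arrival hBm)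
  have hb : 0 ≤ ρ.real B := measureReal_nonneg
  calc ν {ω | firstPoint act pt F ω ≠ firstPoint act pt G ω}
      ≤ 1 - ν {ω | arrival act pt A ω < arrival act pt B ω} :=
        (measure_mono hsub).trans_eq (prob_compl_eq_one_sub hm)
    _ ≤ 1 - ENNReal.ofReal (ρ.real A / (ρ.real A + ρ.real B)) := by gcongr
    _ = ENNReal.ofReal (1 - ρ.real A / (ρ.real A + ρ.real B)) := by
        rw [ENNReal.ofReal_sub _ (by positivity), ENNReal.ofReal_one]
    _ ≤ ENNReal.ofReal (ρ.real B) := by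
        refine ENNReal.ofReal_le_ofReal ?_
        rw [one_sub_div (by linarith), div_le_iff₀ (by linarith)]
        nlinarith
    _ = ρ B := ofReal_measureReal hB'

end

end FirstPoint

section Subgraph

variable {X : Type*} [MeasurableSpace X] {μ P Q : Measure X}

/-- The region below the density of `P` with respect to `μ`. -/
def densityRegion (μ P : Measure X) : Set (X × ℝ) :=
  regionBetween 0 (fun x => (P.rnDeriv μ x).toReal) Set.univ

theorem measurableSet_densityRegion : MeasurableSet (densityRegion μ P) :=
  measurableSet_regionBetween measurable_const (Measure.measurable_rnDeriv P μ).ennreal_toReal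
    MeasurableSet.univ

variable [SigmaFinite μ]

theorem prod_densityRegion_inter [SigmaFinite P] (hP : P ≪ μ) {A : Set X} (hA : MeasurableSet A) :
    (μ.prod volume) (densityRegion μ P ∩ Prod.fst ⁻¹' A) = P A := by
  have h : densityRegion μ P ∩ Prod.fst ⁻¹' A =
      regionBetween 0 (fun x => (P.rnDeriv μ x).toReal) A := by
    ext z
    simp [densityRegion, regionBetween, and_comm]
  rw [h, volume_regionBetween_eq_lintegral (f := 0) aemeasurable_const
    (Measure.measurable_rnDeriv P μ).ennreal_toReal.aemeasurable hA,
    ← Measure.setLIntegral_rnDeriv hP]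
  refine lintegral_congr_ae (ae_restrict_of_ae ?_)
  filter_upwards [Measure.rnDeriv_lt_top P μ] with x hx
  simp [ENNReal.ofReal_toReal hx.ne]

theorem prod_densityRegion [SigmaFinite P] (hP : P ≪ μ) :
    (μ.prod volume) (densityRegion μ P) = P Set.univ := by
  simpa using prod_densityRegion_inter hP MeasurableSet.univ

theorem prod_densityRegion_diff_le [IsProbabilityMeasure P] [IsProbabilityMeasure Q] (hP : P ≪ μ)
    (hQ : Q ≪ μ) {γ : Measure (X × X)} (h₁ : γ.map Prod.fst = P) (h₂ : γ.map Prod.snd = Q) :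
    (μ.prod volume) (densityRegion μ P \ densityRegion μ Q) ≤ γ {z | z.1 ≠ z.2} := by
  set A : Set X := {x | (Q.rnDeriv μ x).toReal < (P.rnDeriv μ x).toReal} with hAdef
  have hA : MeasurableSet A := measurableSet_lt (Measure.measurable_rnDeriv Q μ).ennreal_toReal
    (Measure.measurable_rnDeriv P μ).ennreal_toReal
  have h : (μ.prod volume) (densityRegion μ P \ densityRegion μ Q) + Q A ≤ P A := by
    rw [← prod_densityRegion_inter hP hA, ← prod_densityRegion_inter hQ hA,
      ← measure_union (Set.disjoint_sdiff_left.mono_right Set.inter_subset_left)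
        (measurableSet_densityRegion.inter (measurable_fst hA))]
    refine measure_mono ?_
    rintro ⟨x, u⟩ hx
    simp only [densityRegion, regionBetween, hAdef, Set.mem_union, Set.mem_sdiff, Set.mem_inter_iff,
      Set.mem_ofPred_eq, Set.mem_univ, true_and, Set.mem_Ioo, Pi.zero_apply, Set.mem_preimage,
      not_and, not_lt] at hx ⊢
    rcases hx with ⟨⟨h1, h2⟩, h3⟩ | ⟨⟨h1, h2⟩, h3⟩
    · exact ⟨⟨h1, h2⟩, (h3 h1).trans_lt h2⟩
    · exact ⟨⟨h1, h2.trans h3⟩, h3⟩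
  have h' := h.trans (measure_le_add_of_coupling h₁ h₂ hA)
  rw [add_comm] at h'
  exact ENNReal.le_of_add_le_add_left (measure_ne_top _ _) h'

end Subgraph

theorem exists_coupling_ratio_le_two {X : Type*} [TopologicalSpace X] [PolishSpace X]
    [MeasurableSpace X] [BorelSpace X] (μ : Measure X) [SigmaFinite μ] {A : Type*}
    (P : A → Measure X) [∀ a, IsProbabilityMeasure (P a)] (hP : ∀ a, P a ≪ μ) :
    ∃ f, IsCoupling P f ∧ couplingRatio discreteCost P f ≤ 2 := by
  rcases isEmpty_or_nonempty A with hA | ⟨⟨a₀⟩⟩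
  · refine ⟨fun a => isEmptyElim a, ⟨fun a => isEmptyElim a, fun a => isEmptyElim a⟩,
      sInf_le ⟨by norm_num, fun a => isEmptyElim a⟩⟩
  have : Nonempty X := (P a₀).nonempty_of_neZero
  have hXR : StandardBorelSpace ((X × ℝ) × ℝ) := inferInstance
  have hΩ : StandardBorelSpace (ℕ → ℕ × (ℕ → (X × ℝ) × ℝ)) := inferInstance
  obtain ⟨ν, hν, act, pt, hc⟩ := exists_isPoissonCloud
    ((μ.prod (volume : Measure ℝ)).prod (volume.restrict (Set.Ici (0 : ℝ))))
  have hR : ∀ a, (μ.prod volume) (densityRegion μ (P a)) = 1 := fun a => by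
    rw [prod_densityRegion (hP a), measure_univ]
  have hm : ∀ a, Measurable (firstPoint act pt (densityRegion μ (P a))) := fun a =>
    hc.measurable_firstPoint measurableSet_densityRegion
  refine exists_coupling_ratio_le ν P
    (fun a => Prod.fst ∘ firstPoint act pt (densityRegion μ (P a)))
    (fun a => measurable_fst.comp (hm a)) (fun a => ?_) 2 (by norm_num) fun a b => ?_
  · rw [← Measure.map_map measurable_fst (hm a),
      hc.map_firstPoint measurableSet_densityRegion (hR a)]
    ext s hs
    rw [Measure.map_apply measurable_fst hs, Measure.restrict_apply (measurable_fst hs),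
      Set.inter_comm, prod_densityRegion_inter (hP a) hs]
  · refine le_mul_Cstar (by norm_num) (by norm_num) fun γ _ h₁ h₂ => ?_
    have hswap : (γ.map Prod.swap) {z : X × X | z.1 ≠ z.2} = γ {z | z.1 ≠ z.2} := by
      rw [Measure.map_apply measurable_swap measurableSet_offDiag]
      congr 1
      ext z
      simp [eq_comm]
    have h₁' : (γ.map Prod.swap).map Prod.fst = P b := by
      rw [Measure.map_map measurable_fst measurable_swap]; exact h₂
    have h₂' : (γ.map Prod.swap).map Prod.snd = P a := by
      rw [Measure.map_map measurable_snd measurable_swap]; exact h₁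
    calc ν {ω | (firstPoint act pt (densityRegion μ (P a)) ω).1 ≠
          (firstPoint act pt (densityRegion μ (P b)) ω).1}
        ≤ ν {ω | firstPoint act pt (densityRegion μ (P a)) ω ≠
          firstPoint act pt (densityRegion μ (P b)) ω} :=
          measure_mono fun ω hω h => hω (congrArg Prod.fst h)
      _ ≤ _ := hc.measure_firstPoint_ne_le measurableSet_densityRegion measurableSet_densityRegion
          (hR a) (hR b)
      _ ≤ γ {z | z.1 ≠ z.2} + γ {z | z.1 ≠ z.2} :=
          add_le_add (prod_densityRegion_diff_le (hP a) (hP b) h₁ h₂)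
            ((prod_densityRegion_diff_le (hP b) (hP a) h₁' h₂').trans_eq hswap)
      _ = 2 * γ {z | z.1 ≠ z.2} := (two_mul _).symm

section Quantile

variable {m : ℕ} {R S : Measure (Fin (m + 1))}

/-- The quantile function of a measure on `Fin (m + 1)`. -/
def quantile (R : Measure (Fin (m + 1))) (u : ℝ) : Fin (m + 1) :=
  sInf {k | u ≤ R.real (Set.Iic k)}

theorem quantile_le_iff [IsProbabilityMeasure R] {u : ℝ} (hu : u ≤ 1) (k : Fin (m + 1)) :
    quantile R u ≤ k ↔ u ≤ R.real (Set.Iic k) := by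
  have hne : {k | u ≤ R.real (Set.Iic k)}.Nonempty :=
    ⟨Fin.last m, by simpa [← Fin.top_eq_last] using hu⟩
  have hmem : u ≤ R.real (Set.Iic (quantile R u)) := hne.csInf_mem (Set.toFinite _)
  exact ⟨fun h => hmem.trans (measureReal_mono (Set.Iic_subset_Iic.2 h)), fun h => sInf_le h⟩

theorem measurable_quantile : Measurable (quantile R) :=
  Monotone.measurable fun _ _ huv => sInf_le_sInf fun _ hk => huv.trans hk

theorem map_quantile [IsProbabilityMeasure R] : stdSpace.map (quantile R) = R := by
  have : IsFiniteMeasure stdSpace := by unfold stdSpace; infer_instance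
  refine Measure.ext_of_Iic _ _ fun k => ?_
  rw [Measure.map_apply measurable_quantile measurableSet_Iic, stdSpace,
    Measure.restrict_apply (measurable_quantile measurableSet_Iic)]
  have : quantile R ⁻¹' Set.Iic k ∩ Set.Icc 0 1 = Set.Icc 0 (R.real (Set.Iic k)) := by
    ext u
    simp only [Set.mem_inter_iff, Set.mem_preimage, Set.mem_Iic, Set.mem_Icc]
    refine ⟨fun h => ⟨h.2.1, (quantile_le_iff h.2.2 k).1 h.1⟩, fun h => ?_⟩
    have h1 : u ≤ 1 := h.2.trans measureReal_le_one
    exact ⟨(quantile_le_iff h1 k).2 h.2, h.1, h1⟩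
  rw [this, Real.volume_Icc, sub_zero, ofReal_measureReal]

theorem stdSpace_quantile_le_lt [IsProbabilityMeasure R] [IsProbabilityMeasure S]
    {γ : Measure (Fin (m + 1) × Fin (m + 1))} (h₁ : γ.map Prod.fst = R) (h₂ : γ.map Prod.snd = S)
    (k : Fin (m + 1)) :
    stdSpace {u | quantile R u ≤ k ∧ k < quantile S u} ≤ γ {z | z.1 ≤ k ∧ k < z.2} := by
  have hm : MeasurableSet {u | quantile R u ≤ k ∧ k < quantile S u} :=
    (measurable_quantile measurableSet_Iic).inter (measurable_quantile measurableSet_Ioi)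
  rw [stdSpace, Measure.restrict_apply hm]
  have hsub : {u | quantile R u ≤ k ∧ k < quantile S u} ∩ Set.Icc 0 1 ⊆
      Set.Ioc (S.real (Set.Iic k)) (R.real (Set.Iic k)) := by
    rintro u ⟨⟨h1, h2⟩, -, hu⟩
    exact ⟨lt_of_not_ge fun h => h2.not_ge ((quantile_le_iff hu k).2 h),
      (quantile_le_iff hu k).1 h1⟩
  refine (measure_mono hsub).trans ?_
  rw [Real.volume_Ioc, ENNReal.ofReal_sub _ measureReal_nonneg, ofReal_measureReal,
    ofReal_measureReal, tsub_le_iff_right, ← h₁, ← h₂,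
    Measure.map_apply measurable_fst measurableSet_Iic,
    Measure.map_apply measurable_snd measurableSet_Iic]
  refine (measure_mono fun z hz => ?_).trans (measure_union_le _ _)
  by_cases h : k < z.2
  · exact Or.inl ⟨hz, h⟩
  · exact Or.inr (not_lt.1 h)

theorem stdSpace_quantile_ne_le [IsProbabilityMeasure R] [IsProbabilityMeasure S]
    {γ : Measure (Fin (m + 1) × Fin (m + 1))} (h₁ : γ.map Prod.fst = R) (h₂ : γ.map Prod.snd = S) :
    stdSpace {u | quantile R u ≠ quantile S u} ≤
      ∫⁻ z, (((z.1 - z.2 : ℕ) + (z.2 - z.1 : ℕ) : ℕ) : ℝ≥0∞) ∂γ := by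
  have h₁' : (γ.map Prod.swap).map Prod.fst = S := by
    rw [Measure.map_map measurable_fst measurable_swap]; exact h₂
  have h₂' : (γ.map Prod.swap).map Prod.snd = R := by
    rw [Measure.map_map measurable_snd measurable_swap]; exact h₁
  have hint : ∀ f g : Fin (m + 1) × Fin (m + 1) → Fin (m + 1),
      ∫⁻ z, ((g z - f z : ℕ) : ℝ≥0∞) ∂γ = ∑ k, γ {z | f z ≤ k ∧ k < g z} := by
    intro f g
    have hcount : ∀ z, ((g z - f z : ℕ) : ℝ≥0∞) =
        ∑ k, {z | f z ≤ k ∧ k < g z}.indicator 1 z := by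
      intro z
      rw [← Fin.card_Ico]
      simp only [Set.indicator_apply, Set.mem_ofPred_eq, Pi.one_apply, Finset.sum_boole]
      congr 2
      ext k
      simp
    simp_rw [hcount]
    rw [lintegral_finsetSum _ fun k _ => measurable_of_countable _]
    exact Finset.sum_congr rfl fun k _ => lintegral_indicator_one MeasurableSet.of_discrete
  simp_rw [Nat.cast_add]
  rw [lintegral_add_left (measurable_of_countable _), hint Prod.fst Prod.snd, hint Prod.snd Prod.fst,
    ← Finset.sum_add_distrib]
  have hsub : {u | quantile R u ≠ quantile S u} ⊆ ⋃ k,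
      ({u | quantile S u ≤ k ∧ k < quantile R u} ∪ {u | quantile R u ≤ k ∧ k < quantile S u}) := by
    intro u hu
    rcases lt_or_gt_of_ne hu with h | h
    · exact Set.mem_iUnion.2 ⟨quantile R u, Or.inr ⟨le_rfl, h⟩⟩
    · exact Set.mem_iUnion.2 ⟨quantile S u, Or.inl ⟨le_rfl, h⟩⟩
  refine (measure_mono hsub).trans ((measure_iUnion_fintype_le _ _).trans
    (Finset.sum_le_sum fun k _ => (measure_union_le _ _).trans (add_le_add ?_ ?_)))
  · refine (stdSpace_quantile_le_lt h₁' h₂' k).trans_eq ?_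
    rw [Measure.map_apply measurable_swap MeasurableSet.of_discrete]
    rfl
  · exact stdSpace_quantile_le_lt h₁ h₂ k

theorem sum_perm_dist_le (h1 : 1 ≤ m) (h3 : m ≤ 3) (i j : Fin (m + 1)) :
    3 * ∑ σ : Equiv.Perm (Fin (m + 1)), ((σ i - σ j : ℕ) + (σ j - σ i : ℕ)) ≤
      (m + 1).factorial * ((m + 2) * if i ≠ j then 1 else 0) := by
  revert i j
  interval_cases m <;> decide +kernel

theorem sum_stdSpace_quantile_ne_le (h1 : 1 ≤ m) (h3 : m ≤ 3) [IsProbabilityMeasure R]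
    [IsProbabilityMeasure S] {γ : Measure (Fin (m + 1) × Fin (m + 1))} (h₁ : γ.map Prod.fst = R)
    (h₂ : γ.map Prod.snd = S) :
    3 * ∑ σ : Equiv.Perm (Fin (m + 1)), stdSpace {u | quantile (R.map σ) u ≠ quantile (S.map σ) u} ≤
      (m + 1).factorial * ((m + 2) * γ {z | z.1 ≠ z.2}) := by
  have hσ : ∀ σ : Equiv.Perm (Fin (m + 1)), Measurable σ := fun σ => measurable_of_countable _
  have h : ∀ σ : Equiv.Perm (Fin (m + 1)),
      stdSpace {u | quantile (R.map σ) u ≠ quantile (S.map σ) u} ≤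
      ∫⁻ z, (((σ z.1 - σ z.2 : ℕ) + (σ z.2 - σ z.1 : ℕ) : ℕ) : ℝ≥0∞) ∂γ := by
    intro σ
    have := Measure.isProbabilityMeasure_map (μ := R) (hσ σ).aemeasurable
    have := Measure.isProbabilityMeasure_map (μ := S) (hσ σ).aemeasurable
    have hp := (hσ σ).prodMap (hσ σ)
    refine (stdSpace_quantile_ne_le (γ := γ.map (Prod.map σ σ)) ?_ ?_).trans_eq ?_
    · rw [Measure.map_map measurable_fst hp, ← h₁, Measure.map_map (hσ σ) measurable_fst]
      rfl
    · rw [Measure.map_map measurable_snd hp, ← h₂, Measure.map_map (hσ σ) measurable_snd]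
      rfl
    · exact lintegral_map (measurable_of_countable _) hp
  refine (mul_le_mul_right (Finset.sum_le_sum fun σ _ => h σ) 3).trans ?_
  rw [← lintegral_finsetSum _ fun σ _ => measurable_of_countable _,
    ← lintegral_const_mul _ (measurable_of_countable _),
    ← lintegral_indicator_one (MeasurableSet.of_discrete),
    ← lintegral_const_mul _ (measurable_of_countable _),
    ← lintegral_const_mul _ (measurable_of_countable _)]
  refine lintegral_mono fun z => ?_
  simp only [Set.indicator_apply, Set.mem_ofPred_eq, Pi.one_apply]
  exact_mod_cast sum_perm_dist_le h1 h3 z.1 z.2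

end Quantile

section FiniteSupport

variable {X : Type*} [TopologicalSpace X] [PolishSpace X] [MeasurableSpace X] [BorelSpace X]

theorem exists_coupling_ratio_le_of_mixture {A T : Type*} [Fintype T] [Nonempty T]
    (P : A → Measure X) [∀ a, IsProbabilityMeasure (P a)] (Y : T → A → ℝ → X)
    (hY : ∀ t a, Measurable (Y t a))
    (hlaw : ∀ t a, stdSpace.map (Y t a) = P a) (r : ℝ≥0∞) (hr : 1 ≤ r)
    (h : ∀ a b, (Fintype.card T : ℝ≥0∞)⁻¹ * ∑ t, stdSpace {u | Y t a u ≠ Y t b u} ≤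
      r * Cstar discreteCost (P a) (P b)) :
    ∃ f, IsCoupling P f ∧ couplingRatio discreteCost P f ≤ r := by
  let _ : MeasurableSpace T := ⊤
  have : DiscreteMeasurableSpace T := ⟨fun _ => trivial⟩
  set ν : Measure (T × ℝ) := (Fintype.card T : ℝ≥0∞)⁻¹ • ∑ t, stdSpace.map (Prod.mk t) with hν
  have hcard : (Fintype.card T : ℝ≥0∞) ≠ 0 := by simp
  have hνs : ∀ s, MeasurableSet s →
      ν s = (Fintype.card T : ℝ≥0∞)⁻¹ * ∑ t, stdSpace (Prod.mk t ⁻¹' s) := by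
    intro s hs
    simp only [hν, Measure.smul_apply, Measure.coe_finsetSum, Finset.sum_apply, smul_eq_mul]
    simp_rw [Measure.map_apply measurable_prodMk_left hs]
  have havg : ∀ x : ℝ≥0∞, (Fintype.card T : ℝ≥0∞)⁻¹ * ∑ _t : T, x = x := by
    intro x
    rw [Finset.sum_const, Finset.card_univ, nsmul_eq_mul, ← mul_assoc,
      ENNReal.inv_mul_cancel hcard (by simp), one_mul]
  have hstd : stdSpace Set.univ = 1 := by simp [stdSpace]
  have : IsProbabilityMeasure ν := ⟨by
    rw [hνs _ MeasurableSet.univ]; simp only [Set.preimage_univ, hstd]; exact havg 1⟩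
  have hYm : ∀ a, Measurable fun ω : T × ℝ => Y ω.1 a ω.2 := fun a =>
    measurable_from_prod_countable_right fun t => hY t a
  refine exists_coupling_ratio_le ν P (fun a ω => Y ω.1 a ω.2) hYm (fun a => ?_) r hr fun a b => ?_
  · ext s hs
    rw [Measure.map_apply (hYm a) hs, hνs _ (hYm a hs), ← havg (P a s)]
    congr 1
    refine Finset.sum_congr rfl fun t _ => ?_
    rw [← hlaw t a, Measure.map_apply (hY t a) hs]
    rfl
  · exact (hνs {ω | Y ω.1 a ω.2 ≠ Y ω.1 b ω.2}
      (measurableSet_eq_fun (hYm a) (hYm b)).compl).trans_le (h a b)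

theorem exists_coupling_ratio_le_of_range {m : ℕ} (h1 : 1 ≤ m) (h3 : m ≤ 3) {e : Fin (m + 1) → X}
    (he : Function.Injective e) {A : Type*} (P : A → Measure X) [∀ a, IsProbabilityMeasure (P a)]
    (hP : ∀ a, P a (Set.range e)ᶜ = 0) :
    ∃ f, IsCoupling P f ∧ couplingRatio discreteCost P f ≤ ((m + 1 : ℕ) + 1) / 3 := by
  have hem : Measurable e := measurable_of_countable _
  obtain ⟨g, hg, hge⟩ : ∃ g : X → Fin (m + 1), Measurable g ∧ Function.LeftInverse g e := by
    refine ⟨Function.extend e id fun _ => 0, (hem.measurableEmbedding he).measurable_extend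
      measurable_id measurable_const, fun i => he.extend_apply _ _ i⟩
  have hgP : ∀ a, ((P a).map g).map e = P a := by
    intro a
    rw [Measure.map_map hem hg]
    refine Eq.trans (Measure.map_congr ?_) Measure.map_id
    filter_upwards [compl_mem_ae_iff.2 (hP a)] with x hx
    obtain ⟨i, rfl⟩ := not_not.1 hx
    simp [hge i]
  have hgprob : ∀ a, IsProbabilityMeasure ((P a).map g) := fun a =>
    Measure.isProbabilityMeasure_map hg.aemeasurable
  have hσ : ∀ σ : Equiv.Perm (Fin (m + 1)), Measurable σ := fun σ => measurable_of_countable _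
  have hσprob : ∀ a (σ : Equiv.Perm (Fin (m + 1))), IsProbabilityMeasure (((P a).map g).map σ) :=
    fun a σ => Measure.isProbabilityMeasure_map (hσ σ).aemeasurable
  have hr : (1 : ℝ≥0∞) ≤ ((m + 1 : ℕ) + 1) / 3 := by
    rw [ENNReal.le_div_iff_mul_le (by simp) (by simp)]
    norm_cast
    lia
  have hr' : (((m + 1 : ℕ) + 1) / 3 : ℝ≥0∞) ≠ ∞ :=
    ENNReal.div_ne_top (by finiteness) (by simp)
  refine exists_coupling_ratio_le_of_mixture P (fun (σ : Equiv.Perm (Fin (m + 1))) a =>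
    e ∘ σ.symm ∘ quantile (((P a).map g).map σ))
    (fun σ a => hem.comp ((hσ σ.symm).comp measurable_quantile)) (fun σ a => ?_) _ hr fun a b => ?_
  · rw [← Measure.map_map hem ((hσ σ.symm).comp measurable_quantile),
      ← Measure.map_map (hσ σ.symm) measurable_quantile, map_quantile,
      Measure.map_map (hσ σ.symm) (hσ σ), Equiv.symm_comp_self, Measure.map_id, hgP]
  · refine le_mul_Cstar (one_pos.trans_le hr).ne' hr' fun γ _ hγ₁ hγ₂ => ?_
    have hgg := hg.prodMap hg
    have h := sum_stdSpace_quantile_ne_le h1 h3 (γ := γ.map (Prod.map g g))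
      (R := (P a).map g) (S := (P b).map g)
      (by rw [Measure.map_map measurable_fst hgg, ← hγ₁, Measure.map_map hg measurable_fst]; rfl)
      (by rw [Measure.map_map measurable_snd hgg, ← hγ₂, Measure.map_map hg measurable_snd]; rfl)
    have hne : (γ.map (Prod.map g g)) {z | z.1 ≠ z.2} ≤ γ {z | z.1 ≠ z.2} := by
      rw [Measure.map_apply hgg MeasurableSet.of_discrete]
      exact measure_mono fun z hz h => hz (congrArg g h)
    have hset : ∀ σ : Equiv.Perm (Fin (m + 1)),
        {u | (e ∘ σ.symm ∘ quantile (((P a).map g).map σ)) u ≠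
          (e ∘ σ.symm ∘ quantile (((P b).map g).map σ)) u} =
        {u | quantile (((P a).map g).map σ) u ≠ quantile (((P b).map g).map σ) u} := by
      intro σ
      ext u
      simp [he.eq_iff]
    simp_rw [hset]
    rw [Fintype.card_perm, Fintype.card_fin, mul_comm, ← div_eq_mul_inv,
      ENNReal.div_le_iff (by simp [Nat.factorial_ne_zero]) (by simp)]
    have hrhs : ((m + 1 : ℕ) + 1) / 3 * γ {z | z.1 ≠ z.2} * ((m + 1).factorial : ℝ≥0∞) =
        ((m + 1).factorial * ((m + 2) * γ {z | z.1 ≠ z.2})) / 3 := by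
      simp only [div_eq_mul_inv]
      push_cast
      ring
    rw [hrhs, ENNReal.le_div_iff_mul_le (by simp) (by simp), mul_comm]
    exact h.trans (by gcongr)

end FiniteSupport

theorem exists_injective_of_encard {X : Type*} {S : Set X} {n : ℕ} (h : S.encard = n) :
    ∃ e : Fin n → X, Function.Injective e ∧ Set.range e = S := by
  have hfin : S.Finite := Set.finite_of_encard_eq_coe h
  have : Finite S := hfin
  have hcard : Nat.card S = n := by rw [Nat.card_coe_set_eq, Set.ncard, h]; rfl
  let φ := Finite.equivFinOfCardEq hcard
  exact ⟨fun i => φ.symm i, Subtype.val_injective.comp φ.symm.injective, by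
    rw [← Function.comp_def, φ.symm.surjective.range_comp, Subtype.range_coe]⟩

section Support

variable {X : Type*} [TopologicalSpace X] [PolishSpace X] [MeasurableSpace X]

theorem measure_compl_msupport (μ : Measure X) : μ (msupport μ)ᶜ = 0 := by
  have : msupport μ = μ.support := by
    ext x
    rw [Measure.support_eq_forall_isOpen]
    exact ⟨fun h U hx hU => h U hU hx, fun h U hU hx => h U hx hU⟩
  rw [this, Measure.measure_compl_support]

variable [BorelSpace X]

theorem le_couplingRatio_of_le_encard {μ : Measure X} [SigmaFinite μ] {m : ℕ} (hm : 1 ≤ m)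
    (hμ : ((m + 1 : ℕ) : ℕ∞) ≤ (msupport μ).encard)
    {f : {P : ProbabilityMeasure X // (P : Measure X) ≪ μ} → ℝ → X}
    (hf : IsCoupling (fun P : {P : ProbabilityMeasure X // (P : Measure X) ≪ μ} =>
      (P.1 : Measure X)) f) :
    2 * (1 - ((m + 1 : ℕ) : ℝ≥0∞)⁻¹) ≤ couplingRatio discreteCost
      (fun P : {P : ProbabilityMeasure X // (P : Measure X) ≪ μ} => (P.1 : Measure X)) f := by
  obtain ⟨S, hS, hcard⟩ := Set.exists_subset_encard_eq hμ
  obtain ⟨e, he, rfl⟩ := exists_injective_of_encard hcard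
  obtain ⟨U, hU, hdisj⟩ := (Set.finite_range e).t2_separation
  have hpos : ∀ i, μ.toFinite (U (e i)) ≠ 0 := fun i h =>
    (hS ⟨i, rfl⟩ _ (hU (e i)).2 (hU (e i)).1).ne' (absolutelyContinuous_toFinite μ h)
  let Q : Fin (m + 1) → Measure X := fun i => ProbabilityTheory.cond μ.toFinite (U (e i))
  have hQ : ∀ i, IsProbabilityMeasure (Q i) := fun i =>
    ProbabilityTheory.cond_isProbabilityMeasure (hpos i)
  have hUm : ∀ i, MeasurableSet (U (e i)) := fun i => (hU (e i)).2.measurableSet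
  have hQμ : ∀ i, Q i ≪ μ := fun i =>
    ProbabilityTheory.cond_absolutelyContinuous.trans (toFinite_absolutelyContinuous μ)
  have hprob := isProbabilityMeasure_averageErase (Q := Q) (by simpa using hm)
  exact le_couplingRatio_of_averageErase (Q := Q) (U := fun i => U (e i)) (by simp) hm hUm
    (fun i j hij => hdisj ⟨i, rfl⟩ ⟨j, rfl⟩ (he.ne hij))
    (fun i => by simp [Q, ProbabilityTheory.cond_apply (hUm i)])
    (fun i => ⟨⟨averageErase Q i, hprob i⟩, averageErase_absolutelyContinuous hQμ i⟩)
    (fun i => rfl) hf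

end Support

/-- for a Polish space `X`, a σ-finite Borel measure `μ` whose
topological support has (extended) cardinality `s ≥ 2`, and the discrete metric cost,
the optimal pairwise coupling ratio of the family `P_{≪μ}(X)` of all Borel probability
measures absolutely continuous w.r.t. `μ` satisfies
`2(1 − 1/s) ≤ r*_c(P_{≪μ}(X)) ≤ min {2, (s+1)/3}`; moreover some coupling attains a
pairwise coupling ratio `≤ min {2, (s+1)/3}`, and if `s = ∞` then
`r*_c(P_{≪μ}(X)) = 2`.  (Here `1/∞ = 0` and `(∞+1)/3 = ∞`, as in `ℝ≥0∞`.) -/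
theorem discrete_cost_optRatio_bounds {X : Type*} [TopologicalSpace X] [PolishSpace X]
    [MeasurableSpace X] [BorelSpace X]
    (μ : Measure X) [SigmaFinite μ] (s : ℕ∞) (hs : (msupport μ).encard = s)
    (h2 : 2 ≤ s) :
    2 * (1 - ((s : ℝ≥0∞))⁻¹)
        ≤ optRatio discreteCost
            (fun P : {P : ProbabilityMeasure X // (P : Measure X) ≪ μ} =>
              (P.1 : Measure X)) ∧
      optRatio discreteCost
          (fun P : {P : ProbabilityMeasure X // (P : Measure X) ≪ μ} =>
            (P.1 : Measure X))
        ≤ min 2 (((s : ℝ≥0∞) + 1) / 3) ∧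
      (∃ f, IsCoupling
            (fun P : {P : ProbabilityMeasure X // (P : Measure X) ≪ μ} =>
              (P.1 : Measure X)) f ∧
          couplingRatio discreteCost
              (fun P : {P : ProbabilityMeasure X // (P : Measure X) ≪ μ} =>
                (P.1 : Measure X)) f
            ≤ min 2 (((s : ℝ≥0∞) + 1) / 3)) ∧
      (s = ⊤ →
        optRatio discreteCost
            (fun P : {P : ProbabilityMeasure X // (P : Measure X) ≪ μ} =>
              (P.1 : Measure X)) = 2) := by
  have hlower : 2 * (1 - ((s : ℝ≥0∞))⁻¹) ≤ optRatio discreteCost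
      (fun P : {P : ProbabilityMeasure X // (P : Measure X) ≪ μ} => (P.1 : Measure X)) := by
    refine le_iInf₂ fun f hf => ?_
    have hm : ∀ m : ℕ, 1 ≤ m → ((m + 1 : ℕ) : ℕ∞) ≤ s →
        2 * (1 - ((m + 1 : ℕ) : ℝ≥0∞)⁻¹) ≤ couplingRatio discreteCost
          (fun P : {P : ProbabilityMeasure X // (P : Measure X) ≪ μ} => (P.1 : Measure X)) f :=
      fun m h1 hms => le_couplingRatio_of_le_encard h1 (hs ▸ hms) hf
    induction s using ENat.recTopCoe with
    | top =>
      have hlim : Filter.Tendsto (fun m : ℕ => 2 * (1 - ((m + 1 : ℕ) : ℝ≥0∞)⁻¹)) Filter.atTop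
          (nhds (2 * (1 - 0))) :=
        ENNReal.Tendsto.const_mul (ENNReal.Tendsto.sub tendsto_const_nhds
          (ENNReal.tendsto_inv_nat_nhds_zero.comp (Filter.tendsto_add_atTop_nat 1)) (by simp))
          (by simp)
      simpa using le_of_tendsto hlim
        (Filter.eventually_atTop.2 ⟨1, fun m h1 => hm m h1 le_top⟩)
    | coe n =>
      have hn : 2 ≤ n := by exact_mod_cast h2
      obtain ⟨m, rfl⟩ : ∃ m, n = m + 1 := ⟨n - 1, by lia⟩
      simpa using hm m (by lia) le_rfl
  have hupper : ∃ f, IsCoupling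
      (fun P : {P : ProbabilityMeasure X // (P : Measure X) ≪ μ} => (P.1 : Measure X)) f ∧
      couplingRatio discreteCost
        (fun P : {P : ProbabilityMeasure X // (P : Measure X) ≪ μ} => (P.1 : Measure X)) f
        ≤ min 2 (((s : ℝ≥0∞) + 1) / 3) := by
    by_cases h4 : s ≤ 4
    · lift s to ℕ using ne_top_of_le_ne_top (by simp) h4
      have hs4 : s ≤ 4 := by exact_mod_cast h4
      have hs2 : 2 ≤ s := by exact_mod_cast h2
      obtain ⟨m, rfl⟩ : ∃ m, s = m + 1 := ⟨s - 1, by lia⟩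
      obtain ⟨e, he, hrange⟩ := exists_injective_of_encard hs
      obtain ⟨f, hf, hle⟩ := exists_coupling_ratio_le_of_range (by lia) (by lia) he
        (fun P : {P : ProbabilityMeasure X // (P : Measure X) ≪ μ} => (P.1 : Measure X))
        (fun P => P.2 (hrange ▸ measure_compl_msupport μ))
      refine ⟨f, hf, le_min (hle.trans ?_) (by simpa using hle)⟩
      rw [ENNReal.div_le_iff (by simp) (by simp)]
      norm_cast
      lia
    · obtain ⟨f, hf, hle⟩ := exists_coupling_ratio_le_two μ
        (fun P : {P : ProbabilityMeasure X // (P : Measure X) ≪ μ} => (P.1 : Measure X))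
        (fun P => P.2)
      refine ⟨f, hf, le_min hle (hle.trans ?_)⟩
      rw [ENNReal.le_div_iff_mul_le (by simp) (by simp)]
      have h5 : (5 : ℕ∞) ≤ s := Order.add_one_le_of_lt (not_le.1 h4)
      have h5' : (5 : ℝ≥0∞) ≤ s := by exact_mod_cast ENat.toENNReal_le.2 h5
      calc (2 : ℝ≥0∞) * 3 = 5 + 1 := by norm_num
        _ ≤ s + 1 := by gcongr
  have hopt : optRatio discreteCost
      (fun P : {P : ProbabilityMeasure X // (P : Measure X) ≪ μ} => (P.1 : Measure X)) ≤
      min 2 (((s : ℝ≥0∞) + 1) / 3) := by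
    obtain ⟨f, hf, hle⟩ := hupper
    exact (iInf₂_le f hf).trans hle
  refine ⟨hlower, hopt, hupper, ?_⟩
  rintro rfl
  exact le_antisymm (hopt.trans (min_le_left _ _)) (by simpa using hlower)

end
end

section
/- Let X be a Polish space. The Poisson coupling distance d_PC is a metric on the set of Borel probability measures on X: for all Borel probability measures P, Q, R on X one has d_PC(P,Q) ≥ 0 with d_PC(P,Q) = 0 if and only if P = Q, d_PC(P,Q) = d_PC(Q,P), and d_PC(P,R) ≤ d_PC(P,Q) + d_PC(Q,R). -/
open MeasureTheory ENNReal

noncomputable section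

open Classical in
/-- The Poisson coupling distance between two Borel probability measures `P, Q`:
with `μ := P + Q`, `f := dP/dμ`, `g := dQ/dμ`,
`d_PC(P,Q) = 1 − ∫ (∫ max {f(y)/f(x), g(y)/g(x)} μ(dy))⁻¹ μ(dx)`,
where the outer integrand is declared to be `0` at points with `f(x) = 0` or
`g(x) = 0` (and `ℝ≥0∞`-division gives `a/0 = ∞` for `a > 0`). -/
def dPC {X : Type*} [MeasurableSpace X] (P Q : Measure X) : ℝ :=
  1 - (∫⁻ x,
      (if P.rnDeriv (P + Q) x = 0 ∨ Q.rnDeriv (P + Q) x = 0 then 0 else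
        (∫⁻ y, max (P.rnDeriv (P + Q) y / P.rnDeriv (P + Q) x)
            (Q.rnDeriv (P + Q) y / Q.rnDeriv (P + Q) x) ∂(P + Q))⁻¹)
      ∂(P + Q)).toReal

section PoissonCoupling

variable {X : Type*} [MeasurableSpace X]

/-- The normalising integral of the Poisson coupling of the densities `f` and `g`. -/
def couplingIntegral (ν : Measure X) (f g : X → ℝ≥0∞) (x : X) : ℝ≥0∞ :=
  ∫⁻ y, max (f y / f x) (g y / g x) ∂ν

open Classical in
/-- The density of the event that the Poisson coupling of `f` and `g` selects the same point `x`. -/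
def couplingDensity (ν : Measure X) (f g : X → ℝ≥0∞) (x : X) : ℝ≥0∞ :=
  if f x = 0 ∨ g x = 0 then 0 else (couplingIntegral ν f g x)⁻¹

lemma dPC_eq (P Q : Measure X) :
    dPC P Q = 1 - (∫⁻ x, couplingDensity (P + Q) (P.rnDeriv (P + Q)) (Q.rnDeriv (P + Q)) x
      ∂(P + Q)).toReal := rfl

lemma couplingIntegral_comm (ν : Measure X) (f g : X → ℝ≥0∞) (x : X) :
    couplingIntegral ν f g x = couplingIntegral ν g f x := by
  simp only [couplingIntegral, max_comm]

lemma couplingDensity_comm (ν : Measure X) (f g : X → ℝ≥0∞) (x : X) :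
    couplingDensity ν f g x = couplingDensity ν g f x := by
  simp only [couplingDensity, couplingIntegral_comm ν f g, or_comm]

lemma measurable_couplingDensity (ν : Measure X) [SFinite ν] {f g : X → ℝ≥0∞}
    (hf : Measurable f) (hg : Measurable g) : Measurable (couplingDensity ν f g) := by
  classical
  unfold couplingDensity
  refine Measurable.ite ?_ measurable_const (Measurable.inv ?_)
  · exact (hf (measurableSet_singleton 0)).union (hg (measurableSet_singleton 0))
  · refine Measurable.lintegral_prod_right' (f := fun p : X × X =>
      max (f p.2 / f p.1) (g p.2 / g p.1)) ?_
    fun_prop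

lemma lintegral_div_const {ν : Measure X} {f : X → ℝ≥0∞} (hf : Measurable f)
    (hf1 : ∫⁻ y, f y ∂ν = 1) (c : ℝ≥0∞) : ∫⁻ y, f y / c ∂ν = c⁻¹ := by
  simp only [div_eq_mul_inv]
  rw [lintegral_mul_const _ hf, hf1, one_mul]

lemma couplingDensity_le_left {ν : Measure X} {f g : X → ℝ≥0∞} (hf : Measurable f)
    (hf1 : ∫⁻ y, f y ∂ν = 1) (x : X) : couplingDensity ν f g x ≤ f x := by
  unfold couplingDensity
  split_ifs with h
  · exact zero_le
  · rw [ENNReal.inv_le_iff_inv_le, ← lintegral_div_const hf hf1]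
    exact lintegral_mono fun y => le_max_left _ _

lemma couplingDensity_le_right {ν : Measure X} {f g : X → ℝ≥0∞} (hg : Measurable g)
    (hg1 : ∫⁻ y, g y ∂ν = 1) (x : X) : couplingDensity ν f g x ≤ g x :=
  couplingDensity_comm ν f g x ▸ couplingDensity_le_left hg hg1 x

lemma couplingIntegral_ne_top {ν : Measure X} {f g : X → ℝ≥0∞} (hf : Measurable f)
    (hg : Measurable g) (hf1 : ∫⁻ y, f y ∂ν = 1) (hg1 : ∫⁻ y, g y ∂ν = 1) {x : X}
    (hfx : f x ≠ 0) (hgx : g x ≠ 0) : couplingIntegral ν f g x ≠ ∞ := by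
  refine ne_top_of_le_ne_top (b := (f x)⁻¹ + (g x)⁻¹) (by simp [hfx, hgx]) ?_
  rw [← lintegral_div_const hf hf1, ← lintegral_div_const hg hg1,
    ← lintegral_add_left (hf.div_const _)]
  exact lintegral_mono fun y => max_le le_self_add le_add_self

/-- Convexity of the inverse, for two pairs with equal sums. -/
lemma ENNReal.inv_add_inv_le_of_add_eq {p q m M : ℝ≥0∞} (hm : m ≠ 0) (hp : p ≠ ∞) (hq : q ≠ ∞)
    (hmp : m ≤ p) (hmq : m ≤ q) (h : p + q = m + M) : p⁻¹ + q⁻¹ ≤ m⁻¹ + M⁻¹ := by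
  have hS : m + M ≠ ∞ := h ▸ ENNReal.add_ne_top.2 ⟨hp, hq⟩
  obtain ⟨hm', hM'⟩ := ENNReal.add_ne_top.1 hS
  have hpM : p ≤ M := by
    refine (ENNReal.add_le_add_iff_left hm').1 ?_
    rw [← h, add_comm]
    gcongr
  lift p to NNReal using hp
  lift q to NNReal using hq
  lift m to NNReal using hm'
  lift M to NNReal using hM'
  norm_cast at hm hmp hmq h hpM
  have hm0 : 0 < m := pos_iff_ne_zero.2 hm
  have hp0 : 0 < p := hm0.trans_le hmp
  have hq0 : 0 < q := hm0.trans_le hmq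
  have hM0 : 0 < M := hp0.trans_le hpM
  rw [← ENNReal.coe_inv hp0.ne', ← ENNReal.coe_inv hq0.ne', ← ENNReal.coe_inv hm0.ne',
    ← ENNReal.coe_inv hM0.ne']
  norm_cast
  have h' : (p : ℝ) + q = m + M := by exact_mod_cast h
  have hmp' : (m : ℝ) ≤ p := by exact_mod_cast hmp
  have hmq' : (m : ℝ) ≤ q := by exact_mod_cast hmq
  rw [← NNReal.coe_le_coe]
  push_cast
  have hm1 : (0 : ℝ) < m := hm0
  have hp1 : (0 : ℝ) < p := hp0
  have hq1 : (0 : ℝ) < q := hq0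
  have hM1 : (0 : ℝ) < M := hM0
  rw [inv_add_inv hp1.ne' hq1.ne', inv_add_inv hm1.ne' hM1.ne', h']
  refine div_le_div_of_nonneg_left (by positivity) (by positivity) ?_
  nlinarith [mul_nonneg (sub_nonneg.2 hmp') (sub_nonneg.2 hmq')]

lemma couplingDensity_add_le {ν : Measure X} {f g h : X → ℝ≥0∞} (hf : Measurable f)
    (hg : Measurable g) (hh : Measurable h) (hf1 : ∫⁻ y, f y ∂ν = 1) (hg1 : ∫⁻ y, g y ∂ν = 1)
    (hh1 : ∫⁻ y, h y ∂ν = 1) {x : X} (hgt : g x ≠ ∞) :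
    couplingDensity ν f g x + couplingDensity ν g h x ≤ g x + couplingDensity ν f h x := by
  by_cases hfx : f x = 0
  · calc _ = couplingDensity ν g h x := by simp [couplingDensity, hfx]
      _ ≤ g x := couplingDensity_le_left hg hg1 x
      _ ≤ _ := le_self_add
  by_cases hhx : h x = 0
  · calc _ = couplingDensity ν f g x := by simp [couplingDensity, hhx]
      _ ≤ g x := couplingDensity_le_right hg hg1 x
      _ ≤ _ := le_self_add
  by_cases hgx : g x = 0
  · simp [couplingDensity, hgx]
  simp only [couplingDensity, hfx, hgx, hhx, or_self, if_false]
  set A : X → ℝ≥0∞ := fun y => max (f y / f x) (g y / g x) with hA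
  set C : X → ℝ≥0∞ := fun y => max (g y / g x) (h y / h x) with hC
  have hAm : Measurable A := by fun_prop
  have hCm : Measurable C := by fun_prop
  have hmin : (g x)⁻¹ ≤ ∫⁻ y, min (A y) (C y) ∂ν := by
    rw [← lintegral_div_const hg hg1]
    exact lintegral_mono fun y => le_min (le_max_right _ _) (le_max_left _ _)
  have hmax : couplingIntegral ν f h x ≤ ∫⁻ y, max (A y) (C y) ∂ν :=
    lintegral_mono fun y => max_le_max (le_max_left _ _) (le_max_right _ _)
  have hsum : couplingIntegral ν f g x + couplingIntegral ν g h x =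
      ∫⁻ y, min (A y) (C y) ∂ν + ∫⁻ y, max (A y) (C y) ∂ν := by
    rw [← lintegral_add_left (hAm.min hCm)]
    simp only [min_add_max]
    rw [lintegral_add_left hAm]
    rfl
  calc _ ≤ (∫⁻ y, min (A y) (C y) ∂ν)⁻¹ + (∫⁻ y, max (A y) (C y) ∂ν)⁻¹ :=
        ENNReal.inv_add_inv_le_of_add_eq
          (((ENNReal.inv_pos.2 hgt).trans_le hmin).ne')
          (couplingIntegral_ne_top hf hg hf1 hg1 hfx hgx)
          (couplingIntegral_ne_top hg hh hg1 hh1 hgx hhx)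
          (lintegral_mono fun y => min_le_left _ _) (lintegral_mono fun y => min_le_right _ _) hsum
    _ ≤ _ := add_le_add (ENNReal.inv_le_iff_inv_le.1 hmin) (ENNReal.inv_le_inv.2 hmax)

lemma couplingDensity_mul {ν : Measure X} {f g m : X → ℝ≥0∞} (hf : Measurable f)
    (hg : Measurable g) (hm : Measurable m) {x : X} (hmx : m x ≠ ∞) :
    couplingDensity ν (fun y => f y * m y) (fun y => g y * m y) x =
      m x * couplingDensity (ν.withDensity m) f g x := by
  by_cases hm0 : m x = 0
  · simp [couplingDensity, hm0]
  by_cases h : f x = 0 ∨ g x = 0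
  · simp [couplingDensity, hm0, h]
  have key : couplingIntegral ν (fun y => f y * m y) (fun y => g y * m y) x =
      couplingIntegral (ν.withDensity m) f g x * (m x)⁻¹ := by
    unfold couplingIntegral
    rw [lintegral_withDensity_eq_lintegral_mul _ hm (by fun_prop),
      ← lintegral_mul_const _ (by fun_prop)]
    refine lintegral_congr fun y => ?_
    have aux : ∀ a b : ℝ≥0∞, b ≠ 0 → a * m y / (b * m x) = a / b * (m y * (m x)⁻¹) := by
      intro a b hb
      rw [div_eq_mul_inv, div_eq_mul_inv, ENNReal.mul_inv (.inl hb) (.inr hm0)]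
      ring
    push Not at h
    rw [aux _ _ h.1, aux _ _ h.2, Pi.mul_apply, mul_comm (m y) (max _ _), mul_assoc]
    exact (Monotone.map_max mul_left_mono).symm
  simp only [couplingDensity, mul_eq_zero, hm0, or_false, h, if_false, key]
  rw [ENNReal.mul_inv (.inr (by simp [hm0])) (.inr (by simp [hmx])), inv_inv, mul_comm]

lemma couplingDensity_congr_ae {ν : Measure X} {f f' g g' : X → ℝ≥0∞} (hf : f =ᵐ[ν] f')
    (hg : g =ᵐ[ν] g') : couplingDensity ν f g =ᵐ[ν] couplingDensity ν f' g' := by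
  filter_upwards [hf, hg] with x hfx hgx
  have : couplingIntegral ν f g x = couplingIntegral ν f' g' x := by
    refine lintegral_congr_ae ?_
    filter_upwards [hf, hg] with y hfy hgy
    rw [hfx, hgx, hfy, hgy]
  simp only [couplingDensity, this, hfx, hgx]

/-- The Poisson coupling distance can be computed with any dominating measure. -/
lemma dPC_eq_of_absolutelyContinuous {P Q ν : Measure X} [IsFiniteMeasure P] [IsFiniteMeasure Q]
    [IsFiniteMeasure ν] (hP : P ≪ ν) (hQ : Q ≪ ν) :
    dPC P Q = 1 - (∫⁻ x, couplingDensity ν (P.rnDeriv ν) (Q.rnDeriv ν) x ∂ν).toReal := by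
  rw [dPC_eq]
  congr 2
  set f := P.rnDeriv (P + Q)
  set g := Q.rnDeriv (P + Q)
  set m := (P + Q).rnDeriv ν
  have hf : Measurable f := Measure.measurable_rnDeriv _ _
  have hg : Measurable g := Measure.measurable_rnDeriv _ _
  have hm : Measurable m := Measure.measurable_rnDeriv _ _
  have hμ : P + Q = ν.withDensity m :=
    (Measure.withDensity_rnDeriv_eq _ _ (Measure.AbsolutelyContinuous.add_left hP hQ)).symm
  have hPf : (fun y => f y * m y) =ᵐ[ν] P.rnDeriv ν :=
    Measure.rnDeriv_mul_rnDeriv (Measure.AbsolutelyContinuous.rfl.add_right Q)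
  have hQg : (fun y => g y * m y) =ᵐ[ν] Q.rnDeriv ν :=
    Measure.rnDeriv_mul_rnDeriv (add_comm Q P ▸ Measure.AbsolutelyContinuous.rfl.add_right P)
  have hd := measurable_couplingDensity (P + Q) hf hg
  rw [hμ] at hd ⊢
  rw [lintegral_withDensity_eq_lintegral_mul _ hm hd]
  refine lintegral_congr_ae ?_
  filter_upwards [couplingDensity_congr_ae hPf hQg, Measure.rnDeriv_ne_top (P + Q) ν] with x hx hmx
  rw [← hx, couplingDensity_mul hf hg hm hmx, Pi.mul_apply]

lemma lintegral_rnDeriv_eq_one {P ν : Measure X} [IsProbabilityMeasure P] [SigmaFinite ν]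
    (h : P ≪ ν) : ∫⁻ x, P.rnDeriv ν x ∂ν = 1 := by
  rw [Measure.lintegral_rnDeriv h, measure_univ]

lemma lintegral_couplingDensity_le_one {ν : Measure X} {f g : X → ℝ≥0∞} (hf : Measurable f)
    (hf1 : ∫⁻ y, f y ∂ν = 1) : ∫⁻ x, couplingDensity ν f g x ∂ν ≤ 1 :=
  hf1 ▸ lintegral_mono (couplingDensity_le_left hf hf1)

lemma dPC_comm (P Q : Measure X) : dPC P Q = dPC Q P := by
  simp only [dPC_eq, add_comm P Q, couplingDensity_comm _ (P.rnDeriv _)]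

lemma dPC_nonneg (P Q : Measure X) [IsProbabilityMeasure P] [IsProbabilityMeasure Q] :
    0 ≤ dPC P Q := by
  rw [dPC_eq, sub_nonneg]
  exact ENNReal.toReal_le_of_le_ofReal zero_le_one (by
    simpa using lintegral_couplingDensity_le_one (Measure.measurable_rnDeriv _ _)
      (lintegral_rnDeriv_eq_one (Measure.AbsolutelyContinuous.rfl.add_right Q)))

lemma dPC_self (P : Measure X) [IsProbabilityMeasure P] : dPC P P = 0 := by
  have hP : P ≪ P := .rfl
  have h1 := lintegral_rnDeriv_eq_one hP
  have hd : couplingDensity P (P.rnDeriv P) (P.rnDeriv P) = P.rnDeriv P := by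
    ext x
    by_cases hx : P.rnDeriv P x = 0
    · simp [couplingDensity, hx]
    · simp only [couplingDensity, hx, or_self, if_false, couplingIntegral, max_self]
      rw [lintegral_div_const (Measure.measurable_rnDeriv _ _) h1, inv_inv]
  rw [dPC_eq_of_absolutelyContinuous hP hP, hd, h1]
  simp

lemma eq_of_dPC_eq_zero {P Q : Measure X} [IsProbabilityMeasure P] [IsProbabilityMeasure Q]
    (h : dPC P Q = 0) : P = Q := by
  have hP : P ≪ P + Q := Measure.AbsolutelyContinuous.rfl.add_right Q
  have hQ : Q ≪ P + Q := add_comm Q P ▸ Measure.AbsolutelyContinuous.rfl.add_right P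
  have hfm := Measure.measurable_rnDeriv P (P + Q)
  have hgm := Measure.measurable_rnDeriv Q (P + Q)
  have hf1 := lintegral_rnDeriv_eq_one hP
  have hg1 := lintegral_rnDeriv_eq_one hQ
  have hs : ∫⁻ x, couplingDensity (P + Q) (P.rnDeriv (P + Q)) (Q.rnDeriv (P + Q)) x
      ∂(P + Q) = 1 := by
    rw [dPC_eq, sub_eq_zero] at h
    exact (ENNReal.toReal_eq_one_iff _).1 h.symm
  have hf := ae_eq_of_ae_le_of_lintegral_le (ae_of_all _ (couplingDensity_le_left hfm hf1))
    (hs ▸ one_ne_top) hfm.aemeasurable (by rw [hf1, hs])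
  have hg := ae_eq_of_ae_le_of_lintegral_le (ae_of_all _ (couplingDensity_le_right hgm hg1))
    (hs ▸ one_ne_top) hgm.aemeasurable (by rw [hg1, hs])
  rw [← Measure.withDensity_rnDeriv_eq P (P + Q) hP, withDensity_congr_ae (hf.symm.trans hg),
    Measure.withDensity_rnDeriv_eq Q (P + Q) hQ]

lemma dPC_triangle (P Q R : Measure X) [IsProbabilityMeasure P] [IsProbabilityMeasure Q]
    [IsProbabilityMeasure R] : dPC P R ≤ dPC P Q + dPC Q R := by
  set ν := P + Q + R with hν
  have hP : P ≪ ν := (Measure.AbsolutelyContinuous.rfl.add_right Q).add_right R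
  have hQ : Q ≪ ν :=
    (add_comm Q P ▸ Measure.AbsolutelyContinuous.rfl.add_right P : Q ≪ P + Q).add_right R
  have hR : R ≪ ν := by
    rw [hν, add_comm]
    exact Measure.AbsolutelyContinuous.rfl.add_right _
  have hfm := Measure.measurable_rnDeriv P ν
  have hgm := Measure.measurable_rnDeriv Q ν
  have hhm := Measure.measurable_rnDeriv R ν
  have hf1 := lintegral_rnDeriv_eq_one hP
  have hg1 := lintegral_rnDeriv_eq_one hQ
  have hh1 := lintegral_rnDeriv_eq_one hR
  rw [dPC_eq_of_absolutelyContinuous hP hR, dPC_eq_of_absolutelyContinuous hP hQ,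
    dPC_eq_of_absolutelyContinuous hQ hR]
  have hfin : ∀ {f g : X → ℝ≥0∞}, Measurable f → ∫⁻ y, f y ∂ν = 1 →
      ∫⁻ x, couplingDensity ν f g x ∂ν ≠ ∞ := fun hf h1 =>
    ne_top_of_le_ne_top one_ne_top (lintegral_couplingDensity_le_one hf h1)
  have key : ∫⁻ x, couplingDensity ν (P.rnDeriv ν) (Q.rnDeriv ν) x ∂ν +
      ∫⁻ x, couplingDensity ν (Q.rnDeriv ν) (R.rnDeriv ν) x ∂ν ≤
      1 + ∫⁻ x, couplingDensity ν (P.rnDeriv ν) (R.rnDeriv ν) x ∂ν := by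
    rw [← hg1, ← lintegral_add_left (measurable_couplingDensity ν hfm hgm),
      ← lintegral_add_left hgm]
    refine lintegral_mono_ae ?_
    filter_upwards [Measure.rnDeriv_ne_top Q ν] with x hx
    exact couplingDensity_add_le hfm hgm hhm hf1 hg1 hh1 hx
  have := ENNReal.toReal_mono (ENNReal.add_ne_top.2 ⟨one_ne_top, hfin hfm hf1⟩) key
  rw [ENNReal.toReal_add (hfin hfm hf1) (hfin hgm hg1),
    ENNReal.toReal_add one_ne_top (hfin hfm hf1), toReal_one] at this
  linarith

end PoissonCoupling

/-- on a Polish space `X`, the Poisson coupling distance `d_PC` is a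
metric on the Borel probability measures: it is nonnegative, vanishes exactly on the
diagonal, is symmetric, and satisfies the triangle inequality. -/
theorem dPC_is_metric {X : Type*} [TopologicalSpace X] [PolishSpace X]
    [MeasurableSpace X] [BorelSpace X]
    (P Q R : Measure X) [IsProbabilityMeasure P] [IsProbabilityMeasure Q]
    [IsProbabilityMeasure R] :
    0 ≤ dPC P Q ∧ (dPC P Q = 0 ↔ P = Q) ∧ dPC P Q = dPC Q P ∧
      dPC P R ≤ dPC P Q + dPC Q R := by
  exact ⟨dPC_nonneg P Q, ⟨eq_of_dPC_eq_zero, fun h => h ▸ dPC_self P⟩, dPC_comm P Q,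
    dPC_triangle P Q R⟩

end
end
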